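/- arXiv:1911.01564 — 2 statements merged into one kernel-verified Lean document; each statement's English description precedes it below -/
import Mathlib

section
/- Let Π ⊊ Σ_k be a proper subshift with Π equal to the closure of ∪_{μ ∈ M(Π,σ)} supp(μ), and T : Π → Σ_k the map constructed from Π. Then ω_{B*}(T(y)) = Π for every y ∈ Π. -/
open Filter Topology MeasureTheory

/-- Upper density of a set of naturals. -/
noncomputable def upperDensity (S : Set ℕ) : ℝ :=
  Filter.limsup (fun n => ((S ∩ Set.Iio n).ncard : ℝ) / n) Filter.atTop

/-- Lower density of a set of naturals. -/
noncomputable def lowerDensity (S : Set ℕ) : ℝ :=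
  Filter.liminf (fun n => ((S ∩ Set.Iio n).ncard : ℝ) / n) Filter.atTop

/-- Banach upper density: limsup over the interval length of the maximal
proportion of `S` in an interval of that length. -/
noncomputable def banachUpperDensity (S : Set ℕ) : ℝ :=
  Filter.limsup (fun N => ⨆ a : ℕ, ((S ∩ Set.Ico a (a + N)).ncard : ℝ) / N) Filter.atTop

/-- Banach lower density. -/
noncomputable def banachLowerDensity (S : Set ℕ) : ℝ :=
  Filter.liminf (fun N => ⨅ a : ℕ, ((S ∩ Set.Ico a (a + N)).ncard : ℝ) / N) Filter.atTop

/-- The shift map on the full shift `Σ_k = {0, …, k-1}^ℕ`. -/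
def shift {k : ℕ} (x : ℕ → Fin k) : ℕ → Fin k := fun n => x (n + 1)

/-- The metric `d(x,y) = Σ_{n ≥ 1} δ(x_n, y_n)/2^n` on `Σ_k` (sequences indexed from `0`). -/
noncomputable def shiftDist {k : ℕ} (x y : ℕ → Fin k) : ℝ :=
  ∑' n : ℕ, if x n = y n then 0 else (1 / 2) ^ (n + 1)

/-- The open ball `B_ε(x)` for the metric `shiftDist`. -/
def sball {k : ℕ} (x : ℕ → Fin k) (ε : ℝ) : Set (ℕ → Fin k) := {y | shiftDist x y < ε}

/-- `N(x, U) = {n ≥ 1 : σ^n(x) ∈ U}`. -/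
def visits {k : ℕ} (x : ℕ → Fin k) (U : Set (ℕ → Fin k)) : Set ℕ :=
  {n | 1 ≤ n ∧ shift^[n] x ∈ U}

/-- A point is recurrent if `N(x, B_ε(x)) ≠ ∅` for every `ε > 0`. -/
def Recurrent {k : ℕ} (x : ℕ → Fin k) : Prop := ∀ ε > (0 : ℝ), (visits x (sball x ε)).Nonempty

/-- A point is Banach recurrent if `N(x, B_ε(x))` has positive Banach upper density
for every `ε > 0`. -/
def BanachRecurrent {k : ℕ} (x : ℕ → Fin k) : Prop :=
  ∀ ε > (0 : ℝ), 0 < banachUpperDensity (visits x (sball x ε))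

/-- Statistical ω-limit set w.r.t. a density notion `ξ`:
`ω_ξ(x) = {y : ξ(N(x, B_ε(y))) > 0 for all ε > 0}`. -/
def statOmega {k : ℕ} (ξ : Set ℕ → ℝ) (x : ℕ → Fin k) : Set (ℕ → Fin k) :=
  {y | ∀ ε > (0 : ℝ), 0 < ξ (visits x (sball y ε))}

/-- The usual ω-limit set of `x` under the shift. -/
def omegaLim {k : ℕ} (x : ℕ → Fin k) : Set (ℕ → Fin k) :=
  {y | ∀ ε > (0 : ℝ), ∀ N : ℕ, ∃ n ≥ N, shift^[n] x ∈ sball y ε}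

/-- Density of a subset of `Σ_k` w.r.t. the metric `shiftDist`. -/
def ShiftDense {k : ℕ} (A : Set (ℕ → Fin k)) : Prop :=
  ∀ x : ℕ → Fin k, ∀ ε > (0 : ℝ), ∃ y ∈ A, shiftDist x y < ε

/-- Closure of a subset of `Σ_k` w.r.t. the metric `shiftDist`. -/
def shiftClosure {k : ℕ} (A : Set (ℕ → Fin k)) : Set (ℕ → Fin k) :=
  {z | ∀ ε > (0 : ℝ), ∃ y ∈ A, shiftDist z y < ε}

/-- `Φ^{(n)}_{xy}(t)`: the proportion of times `0 ≤ i < n` with `d(σ^i x, σ^i y) < t`. -/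
noncomputable def PhiN {k : ℕ} (x y : ℕ → Fin k) (n : ℕ) (t : ℝ) : ℝ :=
  (({i | i < n ∧ shiftDist (shift^[i] x) (shift^[i] y) < t}).ncard : ℝ) / n

/-- A pair is DC1 (distributionally chaotic of type 1) if `Φ_{xy}(s) = 0` for some `s > 0`
and `Φ*_{xy}(t) = 1` for all `t > 0`. -/
def DC1Pair {k : ℕ} (x y : ℕ → Fin k) : Prop :=
  (∃ s > (0 : ℝ), Filter.liminf (fun n => PhiN x y n s) Filter.atTop = 0) ∧
  (∀ t > (0 : ℝ), Filter.limsup (fun n => PhiN x y n t) Filter.atTop = 1)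

/-- A set with at least two points is DC1-scrambled if every pair of distinct points is DC1. -/
def DC1Scrambled {k : ℕ} (S : Set (ℕ → Fin k)) : Prop :=
  S.Nontrivial ∧ ∀ x ∈ S, ∀ y ∈ S, x ≠ y → DC1Pair x y

/-- `strictOrEq true A B` means `A ⊊ B`; `strictOrEq false A B` means `A = B`. -/
def strictOrEq {α : Type*} (b : Bool) (A B : Set α) : Prop := if b then A ⊂ B else A = B

/-- The patterns of (strict ⊊ = `true` / equality = `false`) for the three inclusions
`ω_{B_*} ⊆ ω_{d̲} ⊆ ω_{d̄} ⊆ ω_{B*}` in Cases (1)–(6). -/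
def caseFlags : Fin 6 → Bool × Bool × Bool :=
  ![(true, false, false), (true, false, true), (false, true, false),
    (true, true, false), (false, true, true), (true, true, true)]

/-- `x` satisfies Case (i), i = 1,…,6: the chain
`ω_{B_*}(x) ⊆ ω_{d̲}(x) ⊆ ω_{d̄}(x) ⊆ ω_{B*}(x) = ω_σ(x)` with strictness pattern given by
`caseFlags i`, and the last inclusion an equality. -/
def SatCase {k : ℕ} (i : Fin 6) (x : ℕ → Fin k) : Prop :=
  strictOrEq (caseFlags i).1 (statOmega banachLowerDensity x) (statOmega lowerDensity x) ∧
  strictOrEq (caseFlags i).2.1 (statOmega lowerDensity x) (statOmega upperDensity x) ∧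
  strictOrEq (caseFlags i).2.2 (statOmega upperDensity x) (statOmega banachUpperDensity x) ∧
  statOmega banachUpperDensity x = omegaLim x

/-- `x` satisfies Case (i'), i = 1,…,6: as in Case (i) but the last inclusion
`ω_{B*}(x) ⊆ ω_σ(x)` is strict. -/
def SatCase' {k : ℕ} (i : Fin 6) (x : ℕ → Fin k) : Prop :=
  strictOrEq (caseFlags i).1 (statOmega banachLowerDensity x) (statOmega lowerDensity x) ∧
  strictOrEq (caseFlags i).2.1 (statOmega lowerDensity x) (statOmega upperDensity x) ∧
  strictOrEq (caseFlags i).2.2 (statOmega upperDensity x) (statOmega banachUpperDensity x) ∧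
  statOmega banachUpperDensity x ⊂ omegaLim x
/-- A subshift: a nonempty, closed (w.r.t. the metric `shiftDist`), shift-invariant subset. -/
def IsSubshift {k : ℕ} (P : Set (ℕ → Fin k)) : Prop :=
  P.Nonempty ∧ shiftClosure P ⊆ P ∧ ∀ x ∈ P, shift x ∈ P

/-- The first `n` symbols of `y` as a finite word. -/
def prefixWord {k : ℕ} (y : ℕ → Fin k) (n : ℕ) : List (Fin k) :=
  List.ofFn (fun i : Fin n => y i)

/-- A finite word occurs in (the language of) `P` if it is the initial word of
some point of `P`. -/
def IsWordIn {k : ℕ} (w : List (Fin k)) (P : Set (ℕ → Fin k)) : Prop :=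
  ∃ x ∈ P, ∀ i : Fin w.length, x i = w.get i

/-- Data for the construction of the map `T`: an enumeration `C` of all (nonempty) finite
words of the subshift `P`, and a nonempty finite word `A1` not occurring in `P`. -/
structure TData (k : ℕ) (P : Set (ℕ → Fin k)) where
  C : ℕ → List (Fin k)
  A1 : List (Fin k)
  A1_ne : A1 ≠ []
  A1_not : ¬ IsWordIn A1 P
  C_in : ∀ n, IsWordIn (C n) P
  C_surj : ∀ w : List (Fin k), w ≠ [] → IsWordIn w P → ∃ n, C n = w

/-- The words `A_n` of the construction (indexed from `0`, so `TData.A y 0` is the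
paper's `A_1`): `A_{n+1} = A_n B_n A_n`, where `B_n = C_n Y_n ⋯ Y_n` consists of the
word `C_n` followed by `|A_n|²` copies of the initial word `Y_n` of `y` (paper's `Y_n`,
of length `n`, is `prefixWord y (n+1)` in our `0`-based indexing). -/
def TData.A {k : ℕ} {P : Set (ℕ → Fin k)} (D : TData k P) (y : ℕ → Fin k) :
    ℕ → List (Fin k)
  | 0 => D.A1
  | n + 1 =>
      D.A y n ++
        (D.C n ++ (List.replicate ((D.A y n).length ^ 2) (prefixWord y (n + 1))).flatten) ++
        D.A y n

/-- The requirement `|C_n| = o(|A_n|)` as `n → ∞`. -/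
def TData.Small {k : ℕ} {P : Set (ℕ → Fin k)} (D : TData k P) : Prop :=
  ∀ y : ℕ → Fin k,
    Filter.Tendsto (fun n => ((D.C n).length : ℝ) / ((D.A y n).length))
      Filter.atTop (nhds 0)

/-- The map `T`: `T(y) = lim_n A_n` is the sequence whose `i`-th symbol is the `i`-th
symbol of `A_n` for every large `n` (the words `A_n` are nested prefixes of each other,
and `|A_{i+1}| > i`, so the `i`-th symbol of `A_{i+1}` is well defined). -/
def TData.T {k : ℕ} {P : Set (ℕ → Fin k)} (D : TData k P) (y : ℕ → Fin k) : ℕ → Fin k :=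
  fun i => if h : i < (D.A y (i + 1)).length then (D.A y (i + 1)).get ⟨i, h⟩ else y i
/-- The support of a measure on `Σ_k` w.r.t. the metric `shiftDist`. -/
def msupp {k : ℕ} (μ : MeasureTheory.Measure (ℕ → Fin k)) : Set (ℕ → Fin k) :=
  {z | ∀ ε > (0 : ℝ), 0 < μ (sball z ε)}

/-- The set `M(Λ, σ)` of shift-invariant Borel probability measures giving full
measure to `Λ`. -/
def invMeasures {k : ℕ} (Λ : Set (ℕ → Fin k)) : Set (MeasureTheory.Measure (ℕ → Fin k)) :=
  {μ | MeasureTheory.IsProbabilityMeasure μ ∧ μ.map shift = μ ∧ μ Λ = 1}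

/-- `V(x, σ)`: the set of weak* limit points of the sequence of empirical measures
`(1/n) Σ_{i<n} δ_{σ^i x}` of `x`, i.e. probability measures `μ` such that along some
subsequence the Birkhoff averages of every continuous function converge to `∫ g dμ`. -/
def VSet {k : ℕ} (x : ℕ → Fin k) : Set (MeasureTheory.Measure (ℕ → Fin k)) :=
  {μ | MeasureTheory.IsProbabilityMeasure μ ∧ ∃ φ : ℕ → ℕ, StrictMono φ ∧
    ∀ g : C(ℕ → Fin k, ℝ),
      Filter.Tendsto (fun j => (∑ i ∈ Finset.range (φ j), g (shift^[i] x)) / (φ j : ℝ))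
        Filter.atTop (nhds (∫ z, g z ∂μ))}

lemma aux_isWordIn_iff {k : ℕ} (w : List (Fin k)) (P : Set (ℕ → Fin k)) :
    IsWordIn w P ↔ ∃ x ∈ P, ∀ i (h : i < w.length), x i = w[i] := by
  constructor
  · rintro ⟨x, hx, h⟩
    exact ⟨x, hx, fun i hi => h ⟨i, hi⟩⟩
  · rintro ⟨x, hx, h⟩
    exact ⟨x, hx, fun i => h i i.2⟩

lemma aux_word_left {k : ℕ} {P : Set (ℕ → Fin k)} {u v : List (Fin k)}
    (h : IsWordIn (u ++ v) P) : IsWordIn u P := by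
  rw [aux_isWordIn_iff] at *
  obtain ⟨x, hx, h⟩ := h
  refine ⟨x, hx, fun i hi => ?_⟩
  rw [h i (by simp; omega), List.getElem_append_left hi]

lemma aux_word_tail {k : ℕ} {P : Set (ℕ → Fin k)} (hP : IsSubshift P) {a : Fin k}
    {v : List (Fin k)} (h : IsWordIn (a :: v) P) : IsWordIn v P := by
  rw [aux_isWordIn_iff] at *
  obtain ⟨x, hx, h⟩ := h
  refine ⟨shift x, hP.2.2 x hx, fun i hi => ?_⟩
  have := h (i+1) (by simp; omega)
  simpa [shift] using this

lemma aux_word_right {k : ℕ} {P : Set (ℕ → Fin k)} (hP : IsSubshift P) {u v : List (Fin k)}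
    (h : IsWordIn (u ++ v) P) : IsWordIn v P := by
  induction u with
  | nil => simpa using h
  | cons a u ih => exact ih (aux_word_tail hP h)

lemma aux_word_infix {k : ℕ} {P : Set (ℕ → Fin k)} (hP : IsSubshift P) {u v : List (Fin k)}
    (h : IsWordIn v P) (huv : u <:+: v) : IsWordIn u P := by
  obtain ⟨s, t, rfl⟩ := huv
  exact aux_word_right hP (aux_word_left h)

open Classical in
/-- number of bad starting positions -/
noncomputable def auxBad {k : ℕ} (P : Set (ℕ → Fin k)) (L : ℕ) : List (Fin k) → ℕ
  | [] => 0
  | a :: u => auxBad P L u +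
      (if (L ≤ (a :: u).length ∧ IsWordIn ((a :: u).take L) P) then 0 else 1)

lemma aux_bad_le_length {k : ℕ} (P : Set (ℕ → Fin k)) (L : ℕ) (u : List (Fin k)) :
    auxBad P L u ≤ u.length := by
  induction u with
  | nil => simp [auxBad]
  | cons a u ih =>
    rw [auxBad, List.length_cons]
    split_ifs <;> omega

lemma aux_bad_append {k : ℕ} (P : Set (ℕ → Fin k)) (L : ℕ) (u v : List (Fin k)) :
    auxBad P L (u ++ v) ≤ auxBad P L u + auxBad P L v := by
  induction u with
  | nil => simp [auxBad]
  | cons a u ih =>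
    rw [List.cons_append, auxBad, auxBad]
    by_cases h : (L ≤ (a :: u).length ∧ IsWordIn ((a :: u).take L) P)
    · have h2 : (L ≤ (a :: (u ++ v)).length ∧ IsWordIn ((a :: (u ++ v)).take L) P) := by
        refine ⟨?_, ?_⟩
        · have := h.1; simp at *; omega
        · rw [← List.cons_append, List.take_append_of_le_length h.1]; exact h.2
      rw [if_pos h, if_pos h2]; omega
    · rw [if_neg h]; split_ifs <;> omega

lemma aux_bad_word {k : ℕ} {P : Set (ℕ → Fin k)} (hP : IsSubshift P) (L : ℕ) (u : List (Fin k))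
    (h : IsWordIn u P) : auxBad P L u ≤ L := by
  induction u with
  | nil => simp [auxBad]
  | cons a u ih =>
    by_cases hL : L ≤ (a :: u).length
    · rw [auxBad, if_pos ⟨hL, aux_word_infix hP h (List.take_prefix _ _).isInfix⟩]
      exact ih (aux_word_tail hP h)
    · have := aux_bad_le_length P L (a :: u)
      omega

lemma aux_prefix_append {α : Type*} {l u v : List α} (h : l <+: u ++ v) :
    l <+: u ∨ ∃ w, l = u ++ w ∧ w <+: v := by
  obtain ⟨t, ht⟩ := h
  rcases List.append_eq_append_iff.1 ht with ⟨as, h1, h2⟩ | ⟨bs, h1, h2⟩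
  · exact Or.inl ⟨as, h1.symm⟩
  · exact Or.inr ⟨bs, h1, ⟨t, h2.symm⟩⟩

lemma aux_suffix_append {α : Type*} {l u v : List α} (h : l <:+ u ++ v) :
    l <:+ v ∨ ∃ w, l = w ++ v ∧ w <:+ u := by
  obtain ⟨t, ht⟩ := h
  rcases List.append_eq_append_iff.1 ht with ⟨as, h1, h2⟩ | ⟨bs, h1, h2⟩
  · exact Or.inr ⟨as, h2, ⟨t, h1.symm⟩⟩
  · exact Or.inl ⟨bs, h2.symm⟩

lemma aux_badR_append {k : ℕ} (P : Set (ℕ → Fin k)) (L : ℕ) (u v : List (Fin k)) :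
    (auxBad P L (u ++ v) : ℝ) ≤ auxBad P L u + auxBad P L v := by
  exact_mod_cast aux_bad_append P L u v

lemma aux_rep_prefix {k : ℕ} {P : Set (ℕ → Fin k)} (hP : IsSubshift P) (L : ℕ) (Y : List (Fin k))
    (hY : IsWordIn Y P) (δ : ℝ) (hδ0 : 0 ≤ δ) (hδ : (L : ℝ) ≤ δ * Y.length) (r : ℕ)
    (v : List (Fin k)) (hv : v <+: (List.replicate r Y).flatten) :
    (auxBad P L v : ℝ) ≤ δ * v.length + L := by
  induction r generalizing v with
  | zero =>
    simp at hv; subst hv; simp [auxBad]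
  | succ r ih =>
    rw [List.replicate_succ, List.flatten_cons] at hv
    rcases aux_prefix_append hv with h | ⟨w, rfl, hw⟩
    · have : (auxBad P L v : ℝ) ≤ L := by
        exact_mod_cast aux_bad_word hP L v (aux_word_infix hP hY h.isInfix)
      have : 0 ≤ δ * v.length := by positivity
      linarith
    · have h1 := ih w hw
      have h2 : (auxBad P L Y : ℝ) ≤ L := by exact_mod_cast aux_bad_word hP L Y hY
      have h3 := aux_badR_append P L Y w
      rw [List.length_append]; push_cast
      linarith

lemma aux_rep_infix {k : ℕ} {P : Set (ℕ → Fin k)} (hP : IsSubshift P) (L : ℕ) (Y : List (Fin k))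
    (hY : IsWordIn Y P) (δ : ℝ) (hδ0 : 0 ≤ δ) (hδ : (L : ℝ) ≤ δ * Y.length) (r : ℕ)
    (v : List (Fin k)) (hv : v <:+: (List.replicate r Y).flatten) :
    (auxBad P L v : ℝ) ≤ δ * v.length + 2 * L := by
  have hL0 : (0:ℝ) ≤ L := by positivity
  induction r generalizing v with
  | zero =>
    simp at hv; subst hv; simp [auxBad]
  | succ r ih =>
    rw [List.replicate_succ, List.flatten_cons] at hv
    rcases List.infix_append_iff.1 hv with h | h | ⟨a, b, rfl, ha, hb⟩
    · have : (auxBad P L v : ℝ) ≤ L := by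
        exact_mod_cast aux_bad_word hP L v (aux_word_infix hP hY h)
      have : 0 ≤ δ * v.length := by positivity
      linarith
    · exact ih v h
    · have h1 := aux_rep_prefix hP L Y hY δ hδ0 hδ r b hb
      have h2 : (auxBad P L a : ℝ) ≤ L := by
        exact_mod_cast aux_bad_word hP L a (aux_word_infix hP hY ha.isInfix)
      have h3 := aux_badR_append P L a b
      have : 0 ≤ δ * a.length := by positivity
      rw [List.length_append]; push_cast
      linarith

lemma aux_B_infix {k : ℕ} {P : Set (ℕ → Fin k)} (hP : IsSubshift P) (L : ℕ) (C Y : List (Fin k))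
    (hC : IsWordIn C P)
    (hY : IsWordIn Y P) (δ : ℝ) (hδ0 : 0 ≤ δ) (hδ : (L : ℝ) ≤ δ * Y.length) (r : ℕ)
    (v : List (Fin k)) (hv : v <:+: C ++ (List.replicate r Y).flatten) :
    (auxBad P L v : ℝ) ≤ δ * v.length + 2 * L := by
  have hL0 : (0:ℝ) ≤ L := by positivity
  rcases List.infix_append_iff.1 hv with h | h | ⟨a, b, rfl, ha, hb⟩
  · have : (auxBad P L v : ℝ) ≤ L := by
      exact_mod_cast aux_bad_word hP L v (aux_word_infix hP hC h)
    have : 0 ≤ δ * v.length := by positivity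
    linarith
  · exact aux_rep_infix hP L Y hY δ hδ0 hδ r v h
  · have h1 := aux_rep_prefix hP L Y hY δ hδ0 hδ r b hb
    have h2 : (auxBad P L a : ℝ) ≤ L := by
      exact_mod_cast aux_bad_word hP L a (aux_word_infix hP hC ha.isInfix)
    have h3 := aux_badR_append P L a b
    have : 0 ≤ δ * a.length := by positivity
    rw [List.length_append]; push_cast
    linarith

lemma aux_prefixWord {k : ℕ} {P : Set (ℕ → Fin k)} {y : ℕ → Fin k} (hy : y ∈ P) (n : ℕ) :
    IsWordIn (prefixWord y n) P := by
  rw [aux_isWordIn_iff]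
  exact ⟨y, hy, fun i hi => by simp [prefixWord]⟩

lemma aux_A_pos {k : ℕ} {P : Set (ℕ → Fin k)} (D : TData k P) (y : ℕ → Fin k) (n : ℕ) :
    n + 1 ≤ (D.A y n).length := by
  induction n with
  | zero =>
    have := List.length_pos_iff.2 D.A1_ne
    simp only [TData.A]; omega
  | succ n ih =>
    rw [TData.A, List.length_append, List.length_append]; omega

/-- the middle block -/
def auxB {k : ℕ} {P : Set (ℕ → Fin k)} (D : TData k P) (y : ℕ → Fin k) (n : ℕ) : List (Fin k) :=
  D.C n ++ (List.replicate ((D.A y n).length ^ 2) (prefixWord y (n + 1))).flatten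

lemma aux_A_succ {k : ℕ} {P : Set (ℕ → Fin k)} (D : TData k P) (y : ℕ → Fin k) (n : ℕ) :
    D.A y (n+1) = D.A y n ++ auxB D y n ++ D.A y n := rfl

lemma aux_B_length {k : ℕ} {P : Set (ℕ → Fin k)} (D : TData k P) (y : ℕ → Fin k) (n : ℕ) :
    (D.A y n).length ^ 2 ≤ (auxB D y n).length := by
  simp only [auxB, List.length_append, List.length_flatten, List.map_replicate,
    List.sum_replicate, prefixWord, List.length_ofFn, smul_eq_mul]
  nlinarith [Nat.zero_le ((D.A y n).length ^ 2 * n), Nat.zero_le (D.C n).length]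

lemma aux_main_bound {k : ℕ} {P : Set (ℕ → Fin k)} (hP : IsSubshift P) (D : TData k P)
    (y : ℕ → Fin k) (hy : y ∈ P) (L : ℕ) (ε : ℝ) (hε : 0 < ε) :
    ∃ (K : ℝ) (M : ℕ), ∀ n ≥ M, ∀ v, v <:+: D.A y n → (auxBad P L v : ℝ) ≤ ε * v.length + K := by
  obtain ⟨m, hm⟩ := exists_nat_ge ((4 + 4 * L) / ε)
  have hL0 : (0:ℝ) ≤ L := by positivity
  have hm' : 4 + 4 * (L:ℝ) ≤ ε * m := by rw [div_le_iff₀ hε] at hm; linarith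
  -- B bound
  have hB : ∀ n ≥ m, ∀ v, v <:+: auxB D y n →
      (auxBad P L v : ℝ) ≤ ε / 2 * v.length + 2 * L := by
    intro n hn v hv
    refine aux_B_infix hP L (D.C n) (prefixWord y (n+1)) (D.C_in n) (aux_prefixWord hy _) (ε/2)
      (by positivity) ?_ _ v hv
    have hn' : (m:ℝ) ≤ n := by exact_mod_cast hn
    have : ε * m ≤ ε * n := by gcongr
    simp [prefixWord]
    nlinarith
  have hBε : ∀ n ≥ m, ∀ v, v <:+: auxB D y n →
      (auxBad P L v : ℝ) ≤ ε * v.length + 2 * L := by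
    intro n hn v hv
    have h1 := hB n hn v hv
    have : 0 ≤ ε / 2 * v.length := by positivity
    linarith
  -- slack
  have hS : ∀ n ≥ m, 2 * ((D.A y n).length : ℝ) + auxBad P L (auxB D y n)
      ≤ ε * (auxB D y n).length := by
    intro n hn
    have h1 := hB n hn _ (List.infix_refl _)
    have h2 : ((D.A y n).length : ℝ) ^ 2 ≤ (auxB D y n).length := by
      exact_mod_cast aux_B_length D y n
    have h3 : (m : ℝ) + 1 ≤ (D.A y n).length := by
      have := aux_A_pos D y n
      exact_mod_cast (by omega : m + 1 ≤ (D.A y n).length)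
    set a : ℝ := ((D.A y n).length : ℝ)
    have hm0 : (0:ℝ) ≤ m := by positivity
    have h4 : ε / 2 * a ^ 2 ≤ ε / 2 * (auxB D y n).length := by gcongr
    have h5 : (4 + 4 * (L:ℝ)) * a ≤ ε * a * a := by
      have : ε * m ≤ ε * a := by gcongr; linarith
      have ha : 0 ≤ a := by linarith
      exact mul_le_mul_of_nonneg_right (by linarith) ha
    have h6 : (L:ℝ) ≤ L * a := by nlinarith
    nlinarith
  have hlen : ∀ v, (auxBad P L v : ℝ) ≤ v.length := fun v => by
    exact_mod_cast aux_bad_le_length P L v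
  have hfull : ∀ n ≥ m, (auxBad P L (D.A y (n+1)) : ℝ) ≤ ε * (D.A y (n+1)).length := by
    intro n hn
    have h1 := hS n hn
    rw [aux_A_succ]
    have h2 := aux_badR_append P L (D.A y n ++ auxB D y n) (D.A y n)
    have h3 := aux_badR_append P L (D.A y n) (auxB D y n)
    have h4 := hlen (D.A y n)
    simp only [List.length_append]; push_cast
    have : 0 ≤ ε * ((D.A y n).length : ℝ) := by positivity
    linarith
  set K : ℝ := (D.A y (m+1)).length + 2 * L with hK
  have hKL : 2 * (L:ℝ) ≤ K := by rw [hK]; linarith [Nat.cast_nonneg (α := ℝ) (D.A y (m+1)).length]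
  have base : ∀ v, v <:+: D.A y (m+1) → (auxBad P L v : ℝ) ≤ ε * v.length + K := by
    intro v hv
    have h1 := hlen v
    have h2 : (v.length : ℝ) ≤ (D.A y (m+1)).length := by exact_mod_cast hv.length_le
    have : 0 ≤ ε * (v.length : ℝ) := by positivity
    linarith
  have hpre : ∀ n ≥ m+1, ∀ v, v <+: D.A y n → (auxBad P L v : ℝ) ≤ ε * v.length + K := by
    intro n hn
    induction n, hn using Nat.le_induction with
    | base => exact fun v hv => base v hv.isInfix
    | succ n hn ih =>
      intro v hv
      obtain ⟨n', rfl⟩ : ∃ n', n = n' + 1 := ⟨n - 1, by omega⟩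
      have hf := hfull n' (by omega)
      rw [aux_A_succ] at hv
      rcases aux_prefix_append hv with h | ⟨w, rfl, hw⟩
      · rcases aux_prefix_append h with h | ⟨w, rfl, hw⟩
        · exact ih v h
        · have h1 := hBε (n'+1) (by omega) w hw.isInfix
          have h2 := aux_badR_append P L (D.A y (n'+1)) w
          simp only [List.length_append]; push_cast
          linarith
      · have h1 := ih w hw
        have h2 := aux_badR_append P L (D.A y (n'+1) ++ auxB D y (n'+1)) w
        have h3 := aux_badR_append P L (D.A y (n'+1)) (auxB D y (n'+1))
        have h4 := hS (n'+1) (by omega)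
        have h5 : (0:ℝ) ≤ (D.A y (n'+1)).length := by positivity
        simp only [List.length_append]; push_cast
        linarith
  have hsuf : ∀ n ≥ m+1, ∀ v, v <:+ D.A y n → (auxBad P L v : ℝ) ≤ ε * v.length + K := by
    intro n hn
    induction n, hn using Nat.le_induction with
    | base => exact fun v hv => base v hv.isInfix
    | succ n hn ih =>
      intro v hv
      obtain ⟨n', rfl⟩ : ∃ n', n = n' + 1 := ⟨n - 1, by omega⟩
      have hf := hfull n' (by omega)
      rw [aux_A_succ, List.append_assoc] at hv
      rcases aux_suffix_append hv with h | ⟨w, rfl, hw⟩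
      · rcases aux_suffix_append h with h | ⟨w, rfl, hw⟩
        · exact ih v h
        · have h1 := hBε (n'+1) (by omega) w hw.isInfix
          have h2 := aux_badR_append P L w (D.A y (n'+1))
          simp only [List.length_append]; push_cast
          linarith
      · have h1 := ih w hw
        have h2 := aux_badR_append P L w (auxB D y (n'+1) ++ D.A y (n'+1))
        have h3 := aux_badR_append P L (auxB D y (n'+1)) (D.A y (n'+1))
        have h4 := hS (n'+1) (by omega)
        have h5 : (0:ℝ) ≤ (D.A y (n'+1)).length := by positivity
        simp only [List.length_append]; push_cast
        linarith
  refine ⟨3 * K, m+1, fun n hn => ?_⟩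
  induction n, hn using Nat.le_induction with
  | base => intro v hv; linarith [base v hv]
  | succ n hn ih =>
    intro v hv
    rw [aux_A_succ] at hv
    rcases List.infix_append_iff.1 hv with h | h | ⟨a, b, rfl, ha, hb⟩
    · rcases List.infix_append_iff.1 h with h | h | ⟨a, b, rfl, ha, hb⟩
      · exact ih v h
      · linarith [hBε n (by omega) v h]
      · have h1 := hsuf n hn a ha
        have h2 := hBε n (by omega) b hb.isInfix
        have h3 := aux_badR_append P L a b
        simp only [List.length_append]; push_cast
        linarith
    · exact ih v h
    · have h1 := hpre n hn b hb
      have h3 := aux_badR_append P L a b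
      rcases aux_suffix_append ha with h | ⟨w, rfl, hw⟩
      · have h2 := hBε n (by omega) a h.isInfix
        simp only [List.length_append]; push_cast
        linarith
      · have h2 := hsuf n hn w hw
        have h4 := hBε n (by omega) _ (List.infix_refl _)
        have h5 := aux_badR_append P L w (auxB D y n)
        simp only [List.length_append]; push_cast
        linarith

lemma aux_A_prefix {k : ℕ} {P : Set (ℕ → Fin k)} (D : TData k P) (y : ℕ → Fin k) {n m : ℕ}
    (h : n ≤ m) : D.A y n <+: D.A y m := by
  induction m, h using Nat.le_induction with
  | base => exact List.prefix_refl _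
  | succ m _ ih =>
    rw [aux_A_succ, List.append_assoc]
    exact ih.trans (List.prefix_append _ _)

lemma aux_T_get {k : ℕ} {P : Set (ℕ → Fin k)} (D : TData k P) (y : ℕ → Fin k) (n i : ℕ)
    (h : i < (D.A y n).length) : D.T y i = (D.A y n)[i] := by
  have h1 : i < (D.A y (i+1)).length := by have := aux_A_pos D y (i+1); omega
  rw [TData.T, dif_pos h1, List.get_eq_getElem]
  rcases le_total n (i+1) with h2 | h2
  · exact ((aux_A_prefix D y h2).getElem h).symm
  · exact (aux_A_prefix D y h2).getElem h1

lemma aux_A_eq {k : ℕ} {P : Set (ℕ → Fin k)} (D : TData k P) (y : ℕ → Fin k) (n : ℕ) :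
    D.A y n = (List.range' 0 (D.A y n).length).map (D.T y) := by
  apply List.ext_getElem
  · simp
  · intro i h1 h2
    simp [aux_T_get D y n i h1]

lemma aux_window_infix {k : ℕ} {P : Set (ℕ → Fin k)} (D : TData k P) (y : ℕ → Fin k) (n a N : ℕ)
    (h : a + N ≤ (D.A y n).length) : (List.range' a N).map (D.T y) <:+: D.A y n := by
  rw [aux_A_eq]
  obtain ⟨r, hr⟩ := Nat.exists_eq_add_of_le h
  rw [hr, ← List.range'_append, ← List.range'_append]
  simp only [List.map_append]
  simp only [zero_add, one_mul]
  exact List.infix_append _ _ _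

lemma aux_shift_iter {k : ℕ} (x : ℕ → Fin k) (n i : ℕ) : (shift^[n] x) i = x (n + i) := by
  induction n generalizing x with
  | zero => simp
  | succ n ih => rw [Function.iterate_succ_apply, ih, shift]; congr 1; omega

lemma aux_summable {k : ℕ} (x y : ℕ → Fin k) :
    Summable (fun n : ℕ => if x n = y n then (0:ℝ) else (1 / 2) ^ (n + 1)) := by
  refine Summable.of_nonneg_of_le (fun n => ?_) (fun n => ?_)
    ((summable_nat_add_iff 1).2 (summable_geometric_two))
  · split_ifs <;> positivity
  · split_ifs
    · positivity
    · exact le_rfl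

lemma aux_dist_le {k : ℕ} (x y : ℕ → Fin k) (L : ℕ) (h : ∀ i < L, x i = y i) :
    shiftDist x y ≤ (1/2)^L := by
  have hs := aux_summable x y
  rw [shiftDist, ← hs.sum_add_tsum_nat_add L, Finset.sum_eq_zero, zero_add]
  · have h2 : HasSum (fun n : ℕ => ((1:ℝ)/2)^L * ((1/2) * (1/2)^n)) ((1/2)^L * ((1/2) * 2)) :=
      (hasSum_geometric_two.mul_left _).mul_left _
    have h3 := ((summable_nat_add_iff L).2 hs).tsum_le_tsum (g := fun n : ℕ => ((1:ℝ)/2)^L * ((1/2) * (1/2)^n)) (fun n => ?_) h2.summable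
    · rw [h2.tsum_eq] at h3
      simpa using h3
    · split_ifs
      · positivity
      · apply le_of_eq; ring
  · intro i hi
    simp [h i (Finset.mem_range.1 hi)]

lemma aux_agree {k : ℕ} (x y : ℕ → Fin k) (L : ℕ) (h : shiftDist x y < (1/2)^L) :
    ∀ i < L, x i = y i := by
  intro i hi
  by_contra hne
  have h1 := (aux_summable x y).le_tsum i (fun j _ => by split_ifs <;> positivity)
  rw [if_neg hne] at h1
  have h2 : ((1:ℝ)/2)^L ≤ (1/2)^(i+1) := pow_le_pow_of_le_one (by norm_num) (by norm_num) hi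
  have : shiftDist x y = ∑' n : ℕ, if x n = y n then (0:ℝ) else (1 / 2) ^ (n + 1) := rfl
  linarith

lemma aux_ratio_le {S : Set ℕ} (a N : ℕ) : ((S ∩ Set.Ico a (a + N)).ncard : ℝ) / N ≤ 1 := by
  apply div_le_one_of_le₀ _ (by positivity)
  have : (S ∩ Set.Ico a (a + N)).ncard ≤ (Set.Ico a (a+N)).ncard :=
    Set.ncard_le_ncard Set.inter_subset_right (Set.finite_Ico _ _)
  rw [← Finset.coe_Ico, Set.ncard_coe_finset, Nat.card_Ico, Finset.coe_Ico] at this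
  exact_mod_cast (by omega : (S ∩ Set.Ico a (a + N)).ncard ≤ N)

lemma aux_bdd (S : Set ℕ) (N : ℕ) :
    BddAbove (Set.range fun a : ℕ => ((S ∩ Set.Ico a (a + N)).ncard : ℝ) / N) :=
  ⟨1, by rintro _ ⟨a, rfl⟩; exact aux_ratio_le a N⟩

lemma aux_sup_nonneg (S : Set ℕ) (N : ℕ) :
    0 ≤ ⨆ a : ℕ, ((S ∩ Set.Ico a (a + N)).ncard : ℝ) / N :=
  Real.iSup_nonneg fun a => by positivity

lemma aux_density_le (S : Set ℕ) (c : ℝ)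
    (h : ∀ᶠ N : ℕ in atTop, ∀ a : ℕ, ((S ∩ Set.Ico a (a + N)).ncard : ℝ) / N ≤ c) :
    banachUpperDensity S ≤ c := by
  apply Filter.limsup_le_of_le
  · exact Filter.IsBoundedUnder.isCoboundedUnder_le
      ⟨0, Filter.eventually_map.2 (Filter.Eventually.of_forall fun N => aux_sup_nonneg S N)⟩
  · exact h.mono fun N hN => ciSup_le hN

lemma aux_le_density (S : Set ℕ) (c : ℝ)
    (h : ∀ N : ℕ, 1 ≤ N → ∃ a : ℕ, c ≤ ((S ∩ Set.Ico a (a + N)).ncard : ℝ) / N) :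
    c ≤ banachUpperDensity S := by
  apply Filter.le_limsup_of_frequently_le
  · refine Filter.Eventually.frequently (Filter.eventually_atTop.2 ⟨1, fun N hN => ?_⟩)
    obtain ⟨a, ha⟩ := h N hN
    exact ha.trans (le_ciSup (aux_bdd S N) a)
  · exact ⟨1, Filter.eventually_map.2 (Filter.Eventually.of_forall fun N =>
      ciSup_le fun a => aux_ratio_le a N)⟩

lemma aux_count {k : ℕ} {P : Set (ℕ → Fin k)} (x : ℕ → Fin k) (L : ℕ) (hL : 1 ≤ L) (S : Set ℕ)
    (hS : ∀ n ∈ S, ¬ IsWordIn ((List.range' n L).map x) P) (N a : ℕ) :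
    (S ∩ Set.Ico a (a + N)).ncard ≤ auxBad P L ((List.range' a (N + L)).map x) := by
  induction N generalizing a with
  | zero => simp
  | succ N ih =>
    have e : N + 1 + L = (N + L) + 1 := by omega
    rw [e, List.range'_succ, List.map_cons, auxBad]
    have ih' := ih (a+1)
    have hsub : S ∩ Set.Ico a (a + (N+1)) ⊆ (S ∩ Set.Ico (a+1) (a+1+N)) ∪ (S ∩ {a}) := by
      rintro i ⟨hi, h1, h2⟩
      by_cases hia : i = a
      · exact Or.inr ⟨hi, hia⟩
      · exact Or.inl ⟨hi, by omega, by omega⟩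
    have hc := (Set.ncard_le_ncard hsub (((Set.finite_Ico _ _).inter_of_right _).union
      ((Set.finite_singleton a).inter_of_right _))).trans (Set.ncard_union_le _ _)
    by_cases ha : a ∈ S
    · have h1 : (S ∩ {a}).ncard ≤ 1 := by
        rw [← Set.ncard_singleton a]
        exact Set.ncard_le_ncard Set.inter_subset_right (Set.finite_singleton a)
      rw [if_neg]
      · omega
      · rintro ⟨-, h⟩
        apply hS a ha
        rw [← List.map_cons, ← List.range'_succ] at h
        have e2 : ((List.range' a (N + L + 1)).map x).take L = (List.range' a L).map x := by
          apply List.ext_getElem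
          · simp; omega
          · intro i _ _; simp
        rwa [e2] at h
    · have h1 : (S ∩ {a}) = ∅ := by
        ext i; simp; rintro hi rfl; exact ha hi
      rw [h1, Set.ncard_empty] at hc
      omega

lemma aux_upper {k : ℕ} {P : Set (ℕ → Fin k)} (hP : IsSubshift P) (D : TData k P)
    (y : ℕ → Fin k) (hy : y ∈ P) (L : ℕ) (hL : 1 ≤ L) (S : Set ℕ)
    (hS : ∀ n ∈ S, ¬ IsWordIn ((List.range' n L).map (D.T y)) P) :
    banachUpperDensity S ≤ 0 := by
  apply le_of_forall_pos_le_add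
  intro e he
  rw [zero_add]
  obtain ⟨K, M, hK⟩ := aux_main_bound hP D y hy L (e/2) (by positivity)
  apply aux_density_le
  obtain ⟨N0, hN0⟩ := exists_nat_ge ((e/2 * L + K) / (e/2))
  rw [div_le_iff₀ (by positivity)] at hN0
  refine Filter.eventually_atTop.2 ⟨max N0 1, fun N hN a => ?_⟩
  have hN1 : (1:ℝ) ≤ N := by exact_mod_cast (le_max_right _ _).trans hN
  have hN2 : (N0:ℝ) ≤ N := by exact_mod_cast (le_max_left _ _).trans hN
  rw [div_le_iff₀ (by linarith)]
  have h1 : ((S ∩ Set.Ico a (a + N)).ncard : ℝ) ≤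
      auxBad P L ((List.range' a (N + L)).map (D.T y)) := by
    exact_mod_cast aux_count (D.T y) L hL S hS N a
  have h2 := hK (max M (a + (N + L))) (le_max_left _ _) _
    (aux_window_infix D y _ a (N+L) (by
      have := aux_A_pos D y (max M (a + (N + L)))
      have := le_max_right M (a + (N + L))
      omega))
  simp at h2
  have : N0 * (e/2) ≤ N * (e/2) := by gcongr
  linarith

lemma aux_measurable_shift {k : ℕ} : Measurable (shift : (ℕ → Fin k) → (ℕ → Fin k)) :=
  measurable_pi_iff.2 fun n => measurable_pi_apply (n+1)

lemma aux_exists_orbit {k : ℕ} {P : Set (ℕ → Fin k)} {μ : Measure (ℕ → Fin k)}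
    (hμ : μ ∈ invMeasures P) (U : Set (ℕ → Fin k)) (hU : MeasurableSet U) (N : ℕ) :
    ∃ x ∈ P, (N : ℝ) * μ.real U ≤ ({i ∈ Set.Ico 0 N | shift^[i] x ∈ U}).ncard := by
  classical
  obtain ⟨h1, h2, h3⟩ := hμ
  have hmp : MeasurePreserving (shift : (ℕ → Fin k) → _) μ μ := ⟨aux_measurable_shift, h2⟩
  set f : (ℕ → Fin k) → ℝ := fun x => ∑ i ∈ Finset.range N, (shift^[i] ⁻¹' U).indicator 1 x with hf
  have hm : ∀ i, MeasurableSet ((shift : (ℕ → Fin k) → _)^[i] ⁻¹' U) := fun i =>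
    (hmp.iterate i).measurable hU
  have hint : ∀ i ∈ Finset.range N, Integrable ((shift^[i] ⁻¹' U).indicator (1 : (ℕ → Fin k) → ℝ)) μ :=
    fun i _ => (integrable_const (1:ℝ)).indicator (hm i)
  have hfi : Integrable f μ := integrable_finsetSum _ hint
  have hI : ∫ x, f x ∂μ = N * μ.real U := by
    rw [hf, integral_finsetSum _ hint, Finset.sum_congr rfl (g := fun _ => μ.real U)]
    · simp
    · intro i _
      rw [integral_indicator_one (hm i), Measure.real, (hmp.iterate i).measure_preimage hU.nullMeasurableSet]
      rfl
  have hfm : Measurable f := Finset.measurable_fun_sum _ fun i _ => measurable_one.indicator (hm i)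
  set E := {x | (N : ℝ) * μ.real U ≤ f x} with hE
  have hEm : MeasurableSet E := measurableSet_le measurable_const hfm
  have hE0 : μ E ≠ 0 := by
    intro h0
    obtain ⟨x, hx, hx2⟩ := exists_notMem_null_integral_le hfi h0
    exact hx (by rw [hI] at hx2; exact hx2)
  have : ∃ x ∈ P, x ∈ E := by
    by_contra! hcon
    have hsub : P ⊆ Eᶜ := fun x hx => hcon x hx
    have h4 := measure_mono (μ := μ) hsub
    rw [h3, one_le_prob_iff, prob_compl_eq_one_iff hEm] at h4
    exact hE0 h4
  obtain ⟨x, hx, hxE⟩ := this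
  refine ⟨x, hx, hxE.trans (le_of_eq ?_)⟩
  have : {i ∈ Set.Ico 0 N | shift^[i] x ∈ U} =
      (((Finset.range N).filter (fun i => shift^[i] x ∈ U) : Finset ℕ) : Set ℕ) := by
    ext i; simp
  rw [this, Set.ncard_coe_finset, hf]
  simp [Set.indicator_apply, Finset.sum_boole]

lemma aux_lower {k : ℕ} {P : Set (ℕ → Fin k)} (D : TData k P)
    (y z : ℕ → Fin k) (L : ℕ) {μ : Measure (ℕ → Fin k)}
    (hμ : μ ∈ invMeasures P) (S : Set ℕ)
    (hS : ∀ n ≥ 1, (∀ i < L, D.T y (n + i) = z i) → n ∈ S) :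
    μ.real {x | ∀ i < L, x i = z i} ≤ banachUpperDensity S := by
  set U : Set (ℕ → Fin k) := {x | ∀ i < L, x i = z i} with hUdef
  have hU : MeasurableSet U := by
    have : U = ⋂ i, ⋂ (_ : i < L), (fun x : ℕ → Fin k => x i) ⁻¹' {z i} := by
      ext x; simp [hUdef]
    rw [this]
    exact MeasurableSet.iInter fun i => MeasurableSet.iInter fun _ =>
      measurable_pi_apply i (measurableSet_singleton _)
  apply aux_le_density
  intro N hN
  obtain ⟨x, hx, hxc⟩ := aux_exists_orbit hμ U hU N
  set w : List (Fin k) := (List.range' 0 (N + L)).map x with hw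
  have hwl : w.length = N + L := by simp [hw]
  obtain ⟨n, hn⟩ := D.C_surj w (by intro h; rw [h] at hwl; simp at hwl; omega)
    ((aux_isWordIn_iff _ _).2 ⟨x, hx, fun i hi => by simp [hw]⟩)
  set a := (D.A y n).length with ha
  have ha1 : 1 ≤ a := by have := aux_A_pos D y n; omega
  have hT : ∀ i < N + L, D.T y (a + i) = x i := by
    intro i hi
    have hAs : D.A y (n+1) = (D.A y n ++ w) ++ ((List.replicate ((D.A y n).length ^ 2)
        (prefixWord y (n + 1))).flatten ++ D.A y n) := by
      rw [aux_A_succ, auxB, hn]; simp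
    have hlt : a + i < (D.A y n ++ w).length := by rw [List.length_append, hwl]; omega
    rw [aux_T_get D y (n+1) (a+i) (by rw [hAs, List.length_append]; omega)]
    simp only [hAs]
    rw [List.getElem_append_left hlt, List.getElem_append_right (by omega)]
    simp [hw, ha]
  refine ⟨a, ?_⟩
  rw [le_div_iff₀ (by exact_mod_cast hN), mul_comm]
  refine hxc.trans ?_
  norm_cast
  refine Set.ncard_le_ncard_of_injOn (fun i => a + i) ?_ (fun i _ j _ h => by simpa using h)
    ((Set.finite_Ico _ _).inter_of_right _)
  rintro i ⟨⟨-, hi⟩, hiU⟩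
  refine ⟨hS _ (by omega) fun j hj => ?_, by simp, by simpa using hi⟩
  have := hiU j hj
  rw [aux_shift_iter] at this
  rw [← this, ← hT _ (by omega), add_assoc]

/-- **Remark.** If the proper subshift `P` equals the closure of the union of the supports
of its invariant measures, then `ω_{B*}(T(y)) = P` for every `y ∈ P`. -/
theorem T_image_banachUpper_omega_eq (k : ℕ) (hk : 2 ≤ k)
    (P : Set (ℕ → Fin k)) (hP : IsSubshift P) (hproper : P ≠ Set.univ)
    (hfull : P = shiftClosure (⋃ μ ∈ invMeasures P, msupp μ))
    (D : TData k P) (hD : D.Small) (y : ℕ → Fin k) (hy : y ∈ P) :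
    statOmega banachUpperDensity (D.T y) = P := by
  ext z
  constructor
  · intro hz
    by_contra hzP
    have h1 : ∃ ε > (0:ℝ), ∀ p ∈ P, ε ≤ shiftDist z p := by
      by_contra! hcon
      exact hzP (hP.2.1 hcon)
    obtain ⟨ε, hε, h1⟩ := h1
    obtain ⟨L, hL⟩ := exists_pow_lt_of_lt_one hε (by norm_num : (1/2:ℝ) < 1)
    have hL' : (1/2:ℝ)^(L+1) < ε :=
      (pow_le_pow_of_le_one (by norm_num) (by norm_num) (Nat.le_succ L)).trans_lt hL
    have h2 := hz ((1/2)^(L+1)) (by positivity)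
    refine absurd h2 (not_lt.2 (aux_upper hP D y hy (L+1) (by omega) _ ?_))
    rintro n ⟨-, hn⟩ hw
    have h3 := aux_agree _ _ _ hn
    rw [aux_isWordIn_iff] at hw
    obtain ⟨p, hp, hpw⟩ := hw
    have h4 : ∀ i < L + 1, z i = p i := by
      intro i hi
      rw [h3 i hi, aux_shift_iter, hpw i (by simpa using hi)]
      simp
    have h5 := aux_dist_le z p (L+1) h4
    linarith [h1 p hp]
  · intro hz ε hε
    obtain ⟨L, hL⟩ := exists_pow_lt_of_lt_one hε (by norm_num : (1/2:ℝ) < 1)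
    have hz2 := hz
    rw [hfull] at hz2
    obtain ⟨z', hz', hd⟩ := hz2 ((1/2)^L) (by positivity)
    simp only [Set.mem_iUnion] at hz'
    obtain ⟨μ, hμ, hzμ⟩ := hz'
    have hpos := hzμ ((1/2)^L) (by positivity)
    have hpr : IsProbabilityMeasure μ := hμ.1
    have hsub : sball z' ((1/2)^L) ⊆ {x | ∀ i < L, x i = z i} := by
      intro x hx i hi
      rw [aux_agree _ _ _ hd i hi, aux_agree _ _ _ hx i hi]
    have hpos2 : 0 < μ.real {x | ∀ i < L, x i = z i} :=
      ENNReal.toReal_pos (hpos.trans_le (measure_mono hsub)).ne' (measure_ne_top _ _)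
    refine hpos2.trans_le (aux_lower D y z L hμ _ ?_)
    intro n hn h
    refine ⟨hn, ?_⟩
    refine (aux_dist_le z _ L fun i hi => ?_).trans_lt hL
    rw [aux_shift_iter, h i hi]
end

section
/- Let k ≥ 2 and L ≥ 3, and consider the subshift (Π_L, σ). Then for each i = 1,…,6, the set {x ∈ Rec(Π_L) ∩ Trans(Π_L) : x satisfies Case (i)} contains an uncountable DC1-scrambled subset. -/
open Filter Topology MeasureTheory

/-- The subshift of finite type `Π_L ⊆ Σ_k`: sequences in which no `L` consecutive
symbols are all equal. -/
def PiL (k L : ℕ) : Set (ℕ → Fin k) :=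
  {x | ∀ i : ℕ, ∃ j₁ j₂ : ℕ, j₁ < L ∧ j₂ < L ∧ x (i + j₁) ≠ x (i + j₂)}


section helpers

/-- Counting function. -/
noncomputable def cnt (S : Set ℕ) (n : ℕ) : ℝ := ((S ∩ Set.Iio n).ncard : ℝ)

/-- Counting in an interval. -/
noncomputable def cntI (S : Set ℕ) (a b : ℕ) : ℝ := ((S ∩ Set.Ico a b).ncard : ℝ)

/-- Occurrences (at positive times) of the prefix of `y` of length `r` in `z`. -/
def Occ {k : ℕ} (y : ℕ → Fin k) (r : ℕ) (z : ℕ → Fin k) : Set ℕ :=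
  {m | 1 ≤ m ∧ ∀ i < r, z (m + i) = y i}

/-- The prefix of `y` of length `r` does not occur in `z`. -/
def Abs {k : ℕ} (y : ℕ → Fin k) (r : ℕ) (z : ℕ → Fin k) : Prop :=
  ∀ m, ¬ ∀ i < r, z (m + i) = y i

/-- Linear lower bound for the counting function. -/
def LD (S : Set ℕ) : Prop := ∃ d > (0 : ℝ), ∃ K : ℝ, ∀ n : ℕ, d * n - K ≤ cnt S n

theorem shift_iter {k : ℕ} (x : ℕ → Fin k) (n i : ℕ) : shift^[n] x i = x (n + i) := by
  induction n generalizing x i with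
  | zero => simp
  | succ n ih =>
    rw [Function.iterate_succ_apply, ih]
    unfold shift
    congr 1
    omega

theorem summ_aux {k : ℕ} (x y : ℕ → Fin k) :
    Summable (fun n : ℕ => if x n = y n then (0 : ℝ) else (1 / 2) ^ (n + 1)) := by
  refine Summable.of_nonneg_of_le (g := fun n : ℕ => if x n = y n then (0 : ℝ) else (1 / 2) ^ (n + 1))
    (f := fun n : ℕ => (1 / 2 : ℝ) ^ n) ?_ ?_ summable_geometric_two
  · intro n
    split_ifs <;> positivity
  · intro n
    split_ifs
    · positivity
    · exact pow_le_pow_of_le_one (by norm_num) (by norm_num) (by omega)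

theorem dist_lt {k : ℕ} (ε : ℝ) (hε : 0 < ε) : ∃ r : ℕ, ∀ (y z : ℕ → Fin k),
    (∀ i < r, z i = y i) → shiftDist y z < ε := by
  obtain ⟨r, hr⟩ := exists_pow_lt_of_lt_one hε (by norm_num : (1 / 2 : ℝ) < 1)
  refine ⟨r, ?_⟩
  intro y z h
  refine lt_of_le_of_lt ?_ hr
  set f : ℕ → ℝ := fun n : ℕ => if y n = z n then (0 : ℝ) else (1 / 2) ^ (n + 1) with hf
  have hs : Summable f := summ_aux y z
  have h1 : shiftDist y z = ∑' n, f n := rfl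
  have h0 : ∑ i ∈ Finset.range r, f i = 0 :=
    Finset.sum_eq_zero (fun i hi => by simp [hf, h i (Finset.mem_range.1 hi)])
  have h2 : HasSum (fun i : ℕ => (1 / 2 : ℝ) ^ (r + 1) * (1 / 2) ^ i) ((1 / 2) ^ (r + 1) * 2) :=
    hasSum_geometric_two.mul_left _
  have h3 : (1 / 2 : ℝ) ^ (r + 1) * 2 = (1 / 2) ^ r := by rw [pow_succ]; ring
  have h4 : ∑' i, f (i + r) ≤ ∑' i : ℕ, (1 / 2 : ℝ) ^ (r + 1) * (1 / 2) ^ i := by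
    refine Summable.tsum_le_tsum ?_ ((summable_nat_add_iff r).2 hs) h2.summable
    intro i
    have : (1 / 2 : ℝ) ^ (r + 1) * (1 / 2) ^ i = (1 / 2) ^ (i + r + 1) := by
      rw [← pow_add]; congr 1; omega
    rw [this, hf]
    dsimp only
    split_ifs
    · positivity
    · exact le_rfl
  have h5 := hs.sum_add_tsum_nat_add r
  rw [h2.tsum_eq, h3] at h4
  rw [h1, ← h5, h0, zero_add]
  exact h4

theorem lt_dist {k : ℕ} (y z : ℕ → Fin k) (r : ℕ) (h : shiftDist y z < (1 / 2) ^ r) :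
    ∀ i < r, z i = y i := by
  intro i hi
  by_contra hne
  have h1 := (summ_aux y z).le_tsum i (by intro j _; split_ifs <;> positivity)
  rw [if_neg (fun h => hne h.symm)] at h1
  have h2 : (1 / 2 : ℝ) ^ r ≤ (1 / 2) ^ (i + 1) :=
    pow_le_pow_of_le_one (by norm_num) (by norm_num) (by omega)
  unfold shiftDist at h
  linarith

theorem occ_sub {k : ℕ} (ε : ℝ) (hε : 0 < ε) : ∃ r : ℕ, ∀ (y x : ℕ → Fin k),
    Occ y r x ⊆ visits x (sball y ε) := by
  obtain ⟨r, hr⟩ := dist_lt (k := k) ε hε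
  refine ⟨r, ?_⟩
  rintro y x m ⟨h1, h2⟩
  exact ⟨h1, hr _ _ (fun i hi => by rw [shift_iter]; exact h2 i hi)⟩

theorem sub_occ {k : ℕ} (y x : ℕ → Fin k) (r : ℕ) :
    visits x (sball y ((1 / 2) ^ r)) ⊆ Occ y r x := by
  rintro m ⟨h1, h2⟩
  refine ⟨h1, fun i hi => ?_⟩
  have := lt_dist _ _ _ h2 i hi
  rwa [shift_iter] at this

theorem fin1 (S : Set ℕ) (n : ℕ) : (S ∩ Set.Iio n).Finite := (Set.finite_Iio n).inter_of_right S
theorem fin2 (S : Set ℕ) (a b : ℕ) : (S ∩ Set.Ico a b).Finite := (Set.finite_Ico a b).inter_of_right S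

theorem cnt_nonneg (S : Set ℕ) (n : ℕ) : 0 ≤ cnt S n := by unfold cnt; positivity
theorem cntI_nonneg (S : Set ℕ) (a b : ℕ) : 0 ≤ cntI S a b := by unfold cntI; positivity

theorem cnt_mono {S T : Set ℕ} (h : S ⊆ T) (n : ℕ) : cnt S n ≤ cnt T n := by
  unfold cnt
  exact_mod_cast Set.ncard_le_ncard (Set.inter_subset_inter_left _ h) (fin1 T n)

theorem cntI_mono {S T : Set ℕ} (h : S ⊆ T) (a b : ℕ) : cntI S a b ≤ cntI T a b := by
  unfold cntI
  exact_mod_cast Set.ncard_le_ncard (Set.inter_subset_inter_left _ h) (fin2 T a b)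

theorem cntI_le (S : Set ℕ) (a b : ℕ) : cntI S a b ≤ ((b - a : ℕ) : ℝ) := by
  unfold cntI
  have := Set.ncard_le_ncard (Set.inter_subset_right (s := S) (t := Set.Ico a b)) (Set.finite_Ico a b)
  have h2 : (Set.Ico a b).ncard = b - a := by
    rw [← Finset.coe_Ico, Set.ncard_coe_finset, Nat.card_Ico]
  rw [h2] at this
  exact_mod_cast this

theorem cnt_eq (S : Set ℕ) (n : ℕ) : cnt S n = cntI S 0 n := by
  unfold cnt cntI
  congr 3
  ext; simp

theorem cnt_le (S : Set ℕ) (n : ℕ) : cnt S n ≤ n := by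
  rw [cnt_eq]; simpa using cntI_le S 0 n

theorem cntI_split (S : Set ℕ) (a b c : ℕ) (h1 : a ≤ b) (h2 : b ≤ c) :
    cntI S a c = cntI S a b + cntI S b c := by
  unfold cntI
  rw [← Nat.cast_add, ← Set.ncard_union_eq ?_ (fin2 S a b) (fin2 S b c)]
  · rw [← Set.inter_union_distrib_left, Set.Ico_union_Ico_eq_Ico h1 h2]
  · rw [Set.disjoint_left]
    rintro x ⟨_, hx⟩ ⟨_, hy⟩
    simp at hx hy; omega

theorem cntI_empty (S : Set ℕ) (a b : ℕ) (h : ∀ m, a ≤ m → m < b → m ∉ S) : cntI S a b = 0 := by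
  unfold cntI
  have : S ∩ Set.Ico a b = ∅ := by
    ext m; simp only [Set.mem_inter_iff, Set.mem_Ico, Set.mem_empty_iff_false, iff_false]
    rintro ⟨h1, h2, h3⟩; exact h m h2 h3 h1
  rw [this]; simp

/-- Copying occurrences by a translation. -/
theorem cntI_copy (S T : Set ℕ) (m a : ℕ) (h : ∀ i < m, i ∈ S → a + i ∈ T) :
    cnt S m ≤ cntI T a (a + m) := by
  unfold cnt cntI
  have : ((fun i => a + i) '' (S ∩ Set.Iio m)).ncard ≤ (T ∩ Set.Ico a (a + m)).ncard := by
    refine Set.ncard_le_ncard ?_ (fin2 _ _ _)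
    rintro _ ⟨i, ⟨hi, hm⟩, rfl⟩
    exact ⟨h i hm hi, by simp at hm ⊢; omega⟩
  rw [Set.ncard_image_of_injective _ (fun i j h => by simpa using h)] at this
  exact_mod_cast this

theorem ratio_nonneg (S : Set ℕ) (n : ℕ) : 0 ≤ cnt S n / n := by
  have := cnt_nonneg S n; positivity

theorem ratio_le (S : Set ℕ) (n : ℕ) : cnt S n / n ≤ 1 :=
  div_le_one_of_le₀ (cnt_le S n) (by positivity)

theorem bddA {u : ℕ → ℝ} (h1 : ∀ n, u n ≤ 1) : IsBoundedUnder (· ≤ ·) atTop u :=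
  isBoundedUnder_of ⟨1, h1⟩
theorem bddB {u : ℕ → ℝ} (h1 : ∀ n, 0 ≤ u n) : IsBoundedUnder (· ≥ ·) atTop u :=
  isBoundedUnder_of ⟨0, h1⟩

theorem liminf_ge {u : ℕ → ℝ} {d : ℝ} (h1 : ∀ n, u n ≤ 1) (h : ∀ᶠ n in atTop, d ≤ u n) :
    d ≤ liminf u atTop :=
  le_liminf_of_le (bddA h1).isCoboundedUnder_ge h

theorem liminf_le' {u : ℕ → ℝ} {d : ℝ} (h0 : ∀ n, 0 ≤ u n) (h : ∃ᶠ n in atTop, u n ≤ d) :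
    liminf u atTop ≤ d :=
  liminf_le_of_frequently_le h (bddB h0)

theorem limsup_ge {u : ℕ → ℝ} {d : ℝ} (h1 : ∀ n, u n ≤ 1) (h : ∃ᶠ n in atTop, d ≤ u n) :
    d ≤ limsup u atTop :=
  le_limsup_of_frequently_le h (bddA h1)

theorem limsup_le' {u : ℕ → ℝ} {d : ℝ} (h0 : ∀ n, 0 ≤ u n) (h : ∀ᶠ n in atTop, u n ≤ d) :
    limsup u atTop ≤ d :=
  limsup_le_of_le (bddB h0).isCoboundedUnder_le h

theorem lower_le_upper (S : Set ℕ) : lowerDensity S ≤ upperDensity S :=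
  liminf_le_limsup (bddA (ratio_le S)) (bddB (ratio_nonneg S))

theorem lower_pos {S : Set ℕ} {d : ℝ} (hd : 0 < d) (h : ∀ᶠ n : ℕ in atTop, d * n ≤ cnt S n) :
    0 < lowerDensity S := by
  refine lt_of_lt_of_le hd (liminf_ge (ratio_le S) ?_)
  filter_upwards [h, eventually_gt_atTop 0] with n hn h0
  rw [le_div_iff₀ (by exact_mod_cast h0)]; exact hn

theorem upper_pos {S : Set ℕ} {d : ℝ} (hd : 0 < d) (h : ∃ᶠ n : ℕ in atTop, d * n ≤ cnt S n) :
    0 < upperDensity S := by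
  refine lt_of_lt_of_le hd (limsup_ge (ratio_le S) ?_)
  refine (h.and_eventually (eventually_gt_atTop 0)).mono ?_
  rintro n ⟨hn, h0⟩
  rw [le_div_iff₀ (by exact_mod_cast h0)]; exact hn

theorem lower_zero {S : Set ℕ} (h : ∀ ε > (0 : ℝ), ∃ᶠ n : ℕ in atTop, cnt S n ≤ ε * n) :
    ¬ 0 < lowerDensity S := by
  intro hp
  have : lowerDensity S ≤ lowerDensity S / 2 := by
    refine liminf_le' (ratio_nonneg S) ?_
    refine ((h _ (half_pos hp)).and_eventually (eventually_gt_atTop 0)).mono ?_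
    rintro n ⟨hn, h0⟩
    exact (div_le_iff₀ (by exact_mod_cast h0)).2 hn
  linarith

theorem upper_zero {S : Set ℕ} (h : ∀ ε > (0 : ℝ), ∀ᶠ n : ℕ in atTop, cnt S n ≤ ε * n) :
    ¬ 0 < upperDensity S := by
  intro hp
  have : upperDensity S ≤ upperDensity S / 2 := by
    refine limsup_le' (ratio_nonneg S) ?_
    filter_upwards [h _ (half_pos hp), eventually_gt_atTop 0] with n hn h0
    exact (div_le_iff₀ (by exact_mod_cast h0)).2 hn
  linarith

theorem rI_nonneg (S : Set ℕ) (a N : ℕ) : 0 ≤ cntI S a (a + N) / N := by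
  have := cntI_nonneg S a (a + N); positivity
theorem rI_le (S : Set ℕ) (a N : ℕ) : cntI S a (a + N) / N ≤ 1 :=
  div_le_one_of_le₀ (by simpa using cntI_le S a (a + N)) (by positivity)

theorem banUpper_pos {S : Set ℕ} {d : ℝ} (hd : 0 < d)
    (h : ∀ᶠ N : ℕ in atTop, ∃ a, d * N ≤ cntI S a (a + N)) : 0 < banachUpperDensity S := by
  refine lt_of_lt_of_le hd (limsup_ge (fun N => ciSup_le (fun a => rI_le S a N)) ?_)
  refine Eventually.frequently ?_
  filter_upwards [h, eventually_gt_atTop 0] with N ⟨a, ha⟩ h0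
  refine le_trans ?_ (le_ciSup (f := fun a => cntI S a (a + N) / N)
    ⟨1, by rintro _ ⟨a, rfl⟩; exact rI_le S a N⟩ a)
  rw [le_div_iff₀ (by exact_mod_cast h0)]; exact ha

theorem banLower_zero {S : Set ℕ}
    (h : ∀ N : ℕ, ∃ a, cntI S a (a + N) = 0) : ¬ 0 < banachLowerDensity S := by
  rw [not_lt]
  refine liminf_le' (fun N => le_ciInf (fun a => rI_nonneg S a N)) ?_
  refine (Eventually.of_forall ?_).frequently
  intro N
  obtain ⟨a, ha⟩ := h N
  refine le_trans (ciInf_le (f := fun a => cntI S a (a + N) / N)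
    ⟨0, by rintro _ ⟨a, rfl⟩; exact rI_nonneg S a N⟩ a) ?_
  simp [ha]

theorem unbounded_of_upper {S : Set ℕ} (h : 0 < upperDensity S) (N : ℕ) : ∃ n ≥ N, n ∈ S := by
  by_contra hc
  push Not at hc
  refine upper_zero (S := S) ?_ h
  intro ε hε
  obtain ⟨M, hM⟩ := exists_nat_ge ((N : ℝ) / ε)
  filter_upwards [eventually_ge_atTop (max M N)] with n hn
  have h1 : cnt S n ≤ N := by
    rw [cnt_eq, cntI_split S 0 N n (by omega) (by omega), cntI_empty S N n (fun m h1 _ => hc m h1)]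
    have := cntI_le S 0 N
    simpa using this
  have h2 : (M : ℝ) ≤ n := by exact_mod_cast (by omega : M ≤ n)
  rw [div_le_iff₀ hε] at hM
  nlinarith

theorem unbounded_of_banUpper {S : Set ℕ} (h : 0 < banachUpperDensity S) (N : ℕ) :
    ∃ n ≥ N, n ∈ S := by
  by_contra hc
  push Not at hc
  have : banachUpperDensity S ≤ banachUpperDensity S / 2 := by
    refine limsup_le' (fun n => Real.iSup_nonneg (fun a => rI_nonneg S a n)) ?_
    obtain ⟨M, hM⟩ := exists_nat_ge ((N : ℝ) / (banachUpperDensity S / 2))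
    filter_upwards [eventually_ge_atTop M, eventually_gt_atTop 0] with n hn h0
    refine ciSup_le (fun a => ?_)
    change cntI S a (a + n) / n ≤ _
    rw [div_le_iff₀ (by exact_mod_cast h0)]
    have h1 : cntI S a (a + n) ≤ N := by
      by_cases haN : a ≤ N
      · by_cases hN : N ≤ a + n
        · rw [cntI_split S a N (a + n) haN hN, cntI_empty S N _ (fun m h1 _ => hc m h1)]
          have := cntI_le S a N
          have h4 : ((N - a : ℕ) : ℝ) ≤ N := by exact_mod_cast (by omega)
          linarith
        · have := cntI_le S a (a + n)
          have h4 : ((a + n - a : ℕ) : ℝ) ≤ N := by exact_mod_cast (by omega)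
          linarith
      · rw [cntI_empty S _ _ (fun m h1 _ => hc m (by omega))]
        positivity
    have h2 : (M : ℝ) ≤ n := by exact_mod_cast hn
    rw [div_le_iff₀ (half_pos h)] at hM
    nlinarith
  linarith

theorem mem_lower {k : ℕ} {y x : ℕ → Fin k}
    (h : ∀ r, ∃ d > (0 : ℝ), ∀ᶠ n : ℕ in atTop, d * n ≤ cnt (Occ y r x) n) :
    y ∈ statOmega lowerDensity x := by
  intro ε hε
  obtain ⟨r, hr⟩ := occ_sub (k := k) ε hε
  obtain ⟨d, hd, h⟩ := h r
  exact lower_pos hd (h.mono fun n hn => hn.trans (cnt_mono (hr y x) n))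

theorem mem_upper {k : ℕ} {y x : ℕ → Fin k}
    (h : ∀ r, ∃ d > (0 : ℝ), ∃ᶠ n : ℕ in atTop, d * n ≤ cnt (Occ y r x) n) :
    y ∈ statOmega upperDensity x := by
  intro ε hε
  obtain ⟨r, hr⟩ := occ_sub (k := k) ε hε
  obtain ⟨d, hd, h⟩ := h r
  exact upper_pos hd (h.mono fun n hn => hn.trans (cnt_mono (hr y x) n))

theorem not_mem_lower {k : ℕ} {y x : ℕ → Fin k} (r : ℕ)
    (h : ∀ ε > (0 : ℝ), ∃ᶠ n : ℕ in atTop, cnt (Occ y r x) n ≤ ε * n) :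
    y ∉ statOmega lowerDensity x := by
  intro hy
  refine lower_zero ?_ (hy ((1 / 2) ^ r) (by positivity))
  intro ε hε
  exact (h ε hε).mono fun n hn => (cnt_mono (sub_occ y x r) n).trans hn

theorem not_mem_upper {k : ℕ} {y x : ℕ → Fin k} (r : ℕ)
    (h : ∀ ε > (0 : ℝ), ∀ᶠ n : ℕ in atTop, cnt (Occ y r x) n ≤ ε * n) :
    y ∉ statOmega upperDensity x := by
  intro hy
  refine upper_zero ?_ (hy ((1 / 2) ^ r) (by positivity))
  intro ε hε
  exact (h ε hε).mono fun n hn => (cnt_mono (sub_occ y x r) n).trans hn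

theorem mem_banUpper {k : ℕ} {y x : ℕ → Fin k}
    (h : ∀ r, ∃ d > (0 : ℝ), ∀ᶠ N : ℕ in atTop, ∃ a, d * N ≤ cntI (Occ y r x) a (a + N)) :
    y ∈ statOmega banachUpperDensity x := by
  intro ε hε
  obtain ⟨r, hr⟩ := occ_sub (k := k) ε hε
  obtain ⟨d, hd, h⟩ := h r
  refine banUpper_pos hd (h.mono fun n hn => ?_)
  obtain ⟨a, ha⟩ := hn
  exact ⟨a, ha.trans (cntI_mono (hr y x) _ _)⟩

theorem not_mem_banLower {k : ℕ} {y x : ℕ → Fin k} (r : ℕ)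
    (h : ∀ N : ℕ, ∃ a, cntI (Occ y r x) a (a + N) = 0) :
    y ∉ statOmega banachLowerDensity x := by
  intro hy
  refine banLower_zero ?_ (hy ((1 / 2) ^ r) (by positivity))
  intro N
  obtain ⟨a, ha⟩ := h N
  exact ⟨a, le_antisymm (ha ▸ cntI_mono (sub_occ y x r) _ _) (cntI_nonneg _ _ _)⟩

theorem lower_sub_upper {k : ℕ} (x : ℕ → Fin k) :
    statOmega lowerDensity x ⊆ statOmega upperDensity x :=
  fun _ hy ε hε => (hy ε hε).trans_le (lower_le_upper _)

theorem upper_sub_omega {k : ℕ} (x : ℕ → Fin k) :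
    statOmega upperDensity x ⊆ omegaLim x := by
  intro y hy ε hε N
  obtain ⟨n, hn, h⟩ := unbounded_of_upper (hy ε hε) N
  exact ⟨n, hn, h.2⟩

theorem ban_sub_omega {k : ℕ} (x : ℕ → Fin k) :
    statOmega banachUpperDensity x ⊆ omegaLim x := by
  intro y hy ε hε N
  obtain ⟨n, hn, h⟩ := unbounded_of_banUpper (hy ε hε) N
  exact ⟨n, hn, h.2⟩

theorem omega_sub_PiL {k L : ℕ} {x : ℕ → Fin k} (hx : x ∈ PiL k L) : omegaLim x ⊆ PiL k L := by
  intro y hy i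
  obtain ⟨n, -, hn⟩ := hy ((1 / 2) ^ (i + L)) (by positivity) 0
  have h := lt_dist _ _ _ hn
  obtain ⟨j1, j2, h1, h2, h3⟩ := hx (n + i)
  refine ⟨j1, j2, h1, h2, ?_⟩
  rw [← h (i + j1) (by omega), ← h (i + j2) (by omega), shift_iter, shift_iter]
  simpa [add_assoc] using h3

/-- Block structure of `x`. -/
structure Blk {k : ℕ} (x : ℕ → Fin k) (V W : ℕ → ℕ → Fin k) (E l : ℕ → ℕ) : Prop where
  hV : ∀ j i, i < l j → x (E j + i) = V j i
  hW : ∀ j i, E j + l j + i < E (j + 1) → x (E j + l j + i) = W j i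
  hl : ∀ j, j ≤ l j
  hE : ∀ j, (j + 2) * (E j + l j + l (j + 1)) + (E j + l j) + 1 ≤ E (j + 1)

namespace Blk

variable {k : ℕ} {x : ℕ → Fin k} {V W : ℕ → ℕ → Fin k} {E l : ℕ → ℕ}

theorem lt_E (B : Blk x V W E l) (j : ℕ) : E j + l j < E (j + 1) := by
  have := B.hE j; nlinarith

theorem ge_E (B : Blk x V W E l) (j : ℕ) : j ≤ E j := by
  induction j with
  | zero => omega
  | succ j ih => have := B.lt_E j; omega

theorem locate (B : Blk x V W E l) (J n : ℕ) (h : E (J + 1) ≤ n) :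
    ∃ j ≥ J, E (j + 1) ≤ n ∧ n < E (j + 2) := by
  classical
  have hex : ∃ m, n < E m := ⟨n + 1, by have := B.ge_E (n + 1); omega⟩
  have h1 := Nat.find_spec hex
  have hmono : Monotone E := monotone_nat_of_le_succ (fun j => by have := B.lt_E j; omega)
  have h2 : J + 1 < Nat.find hex := by
    by_contra hc
    have := hmono (not_lt.1 hc)
    omega
  obtain ⟨j, hj⟩ : ∃ j, Nat.find hex = j + 2 := ⟨Nat.find hex - 2, by omega⟩
  refine ⟨j, by omega, ?_, by rw [← hj]; exact h1⟩
  have := Nat.find_min hex (m := j + 1) (by omega)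
  omega

/-- lower bound in a window -/
theorem win_lower {z : ℕ → Fin k} {y : ℕ → Fin k} {r a M m : ℕ} {d K : ℝ}
    (hw : ∀ i < M, x (a + i) = z i) (hm : m ≤ M) (hd : 0 < d) (hK : 0 ≤ K)
    (hz : ∀ n : ℕ, d * n - K ≤ cnt (Occ y r z) n) :
    d * m - (K + d * r) ≤ cntI (Occ y r x) a (a + m) := by
  by_cases hr : m ≤ r
  · have h1 : (m : ℝ) ≤ r := by exact_mod_cast hr
    have := cntI_nonneg (Occ y r x) a (a + m)
    nlinarith
  · have h1 := cntI_copy (Occ y r z) (Occ y r x) (m - r) a (by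
      rintro i hi ⟨h1, h2⟩
      refine ⟨by omega, fun t ht => ?_⟩
      rw [add_assoc, hw _ (by omega)]
      exact h2 t ht)
    have h2 := hz (m - r)
    rw [Nat.cast_sub (by omega)] at h2
    rw [cntI_split _ a (a + (m - r)) (a + m) (by omega) (by omega)]
    have := cntI_nonneg (Occ y r x) (a + (m - r)) (a + m)
    nlinarith

theorem win_upper {z : ℕ → Fin k} {y : ℕ → Fin k} {r a M m : ℕ}
    (hw : ∀ i < M, x (a + i) = z i) (hm : m ≤ M) (hz : Abs y r z) :
    cntI (Occ y r x) a (a + m) ≤ r := by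
  by_cases hr : m ≤ r
  · have h1 : (m : ℝ) ≤ r := by exact_mod_cast hr
    have := cntI_le (Occ y r x) a (a + m)
    simp only [add_tsub_cancel_left] at this
    linarith
  · rw [cntI_split _ a (a + (m - r)) (a + m) (by omega) (by omega), cntI_empty]
    · have := cntI_le (Occ y r x) (a + (m - r)) (a + m)
      rw [show a + m - (a + (m - r)) = r by omega] at this
      linarith
    · rintro t h1 h2 ⟨_, h3⟩
      refine hz (t - a) fun i hi => ?_
      rw [← hw _ (by omega), ← h3 i hi]
      congr 1; omega

theorem win_W (B : Blk x V W E l) (j : ℕ) :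
    ∀ i < E (j + 1) - (E j + l j), x (E j + l j + i) = W j i :=
  fun i hi => B.hW j i (by omega)

theorem L1 (B : Blk x V W E l) {y : ℕ → Fin k}
    (h : ∀ r, ∃ d > (0 : ℝ), ∃ K, ∀ j, ∀ n : ℕ, d * n - K ≤ cnt (Occ y r (W j)) n) :
    y ∈ statOmega lowerDensity x := by
  refine mem_lower fun r => ?_
  obtain ⟨d, hd, K0, hz0⟩ := h r
  obtain ⟨K, hK, hz⟩ : ∃ K, 0 ≤ K ∧ ∀ j, ∀ n : ℕ, d * n - K ≤ cnt (Occ y r (W j)) n :=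
    ⟨max K0 0, le_max_right _ _, fun j n => by
      have := hz0 j n; have := le_max_left K0 0; linarith⟩
  refine ⟨d / 4, by positivity, ?_⟩
  obtain ⟨N, hN⟩ := exists_nat_ge ((2 * (K + d * r)) * 4 / d)
  filter_upwards [eventually_ge_atTop (max N (E (0 + 1)))] with n hn
  obtain ⟨j, -, h1, h2⟩ := B.locate 0 n (by omega)
  have a1 := B.lt_E j
  have a2 := win_lower (B.win_W j) le_rfl hd hK (hz j)
  rw [show E j + l j + (E (j + 1) - (E j + l j)) = E (j + 1) by omega,
    Nat.cast_sub a1.le] at a2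
  have a3 : d * ((n : ℝ) - (E (j + 1) + l (j + 1))) - (K + d * r)
      ≤ cntI (Occ y r x) (E (j + 1)) n := by
    by_cases hc : E (j + 1) + l (j + 1) ≤ n
    · have := win_lower (m := n - (E (j + 1) + l (j + 1))) (B.win_W (j + 1)) (by
        show n - _ ≤ E (j + 2) - _
        omega) hd hK (hz (j + 1))
      rw [show E (j + 1) + l (j + 1) + (n - (E (j + 1) + l (j + 1))) = n by omega,
        Nat.cast_sub hc] at this
      push_cast at this
      rw [cntI_split _ (E (j + 1)) (E (j + 1) + l (j + 1)) n (by omega) hc]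
      have := cntI_nonneg (Occ y r x) (E (j + 1)) (E (j + 1) + l (j + 1))
      linarith
    · have h3 : (n : ℝ) ≤ E (j + 1) + l (j + 1) := by exact_mod_cast (by omega)
      have := cntI_nonneg (Occ y r x) (E (j + 1)) n
      have h4 : 0 ≤ d * r := by positivity
      nlinarith
  rw [cnt_eq, cntI_split _ 0 (E j + l j) n (by omega) (by omega),
    cntI_split _ (E j + l j) (E (j + 1)) n (by omega) (by omega)]
  have a4 := cntI_nonneg (Occ y r x) 0 (E j + l j)
  have a5 : 2 * ((E j : ℝ) + l j + l (j + 1)) ≤ n := by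
    have := B.hE j
    exact_mod_cast (by nlinarith : 2 * (E j + l j + l (j + 1)) ≤ n)
  have a6 : (N : ℝ) ≤ n := by exact_mod_cast (by omega : N ≤ n)
  rw [div_le_iff₀ hd] at hN
  push_cast at a2
  nlinarith

theorem L2 (B : Blk x V W E l) {y : ℕ → Fin k}
    (h : ∀ r, ∃ d > (0 : ℝ), ∃ K, ∃ᶠ j in atTop, ∀ n : ℕ, d * n - K ≤ cnt (Occ y r (W j)) n) :
    y ∈ statOmega upperDensity x := by
  refine mem_upper fun r => ?_
  obtain ⟨d, hd, K0, hz0⟩ := h r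
  obtain ⟨K, hK, hz⟩ : ∃ K, 0 ≤ K ∧ ∃ᶠ j in atTop, ∀ n : ℕ, d * n - K ≤ cnt (Occ y r (W j)) n :=
    ⟨max K0 0, le_max_right _ _, hz0.mono fun j hj n => by
      have := hj n; have := le_max_left K0 0; linarith⟩
  refine ⟨d / 4, by positivity, ?_⟩
  obtain ⟨N, hN⟩ := exists_nat_ge ((K + d * r) * 4 / d)
  rw [frequently_atTop] at hz ⊢
  intro M
  obtain ⟨j, hj, hz⟩ := hz (max M N)
  have a1 := B.lt_E j
  have a0 := B.ge_E j
  refine ⟨E (j + 1), by omega, ?_⟩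
  have a2 := win_lower (B.win_W j) le_rfl hd hK hz
  rw [show E j + l j + (E (j + 1) - (E j + l j)) = E (j + 1) by omega,
    Nat.cast_sub a1.le] at a2
  rw [cnt_eq, cntI_split _ 0 (E j + l j) _ (by omega) a1.le]
  have a4 := cntI_nonneg (Occ y r x) 0 (E j + l j)
  have a5 : 2 * ((E j : ℝ) + l j) ≤ E (j + 1) := by
    have := B.hE j
    exact_mod_cast (by nlinarith : 2 * (E j + l j) ≤ E (j + 1))
  have a6 : (N : ℝ) ≤ E (j + 1) := by exact_mod_cast (by omega : N ≤ E (j + 1))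
  rw [div_le_iff₀ hd] at hN
  push_cast at a2
  nlinarith

theorem L3 (B : Blk x V W E l) {y : ℕ → Fin k} (r : ℕ)
    (h : ∃ᶠ j in atTop, Abs y r (W j)) :
    y ∉ statOmega lowerDensity x := by
  refine not_mem_lower r fun ε hε => ?_
  obtain ⟨N, hN⟩ := exists_nat_ge (2 * r / ε)
  obtain ⟨N', hN'⟩ := exists_nat_ge (2 / ε)
  rw [frequently_atTop] at h ⊢
  intro M
  obtain ⟨j, hj, hz⟩ := h (max M (max N N'))
  have a1 := B.lt_E j
  have a0 := B.ge_E j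
  refine ⟨E (j + 1), by omega, ?_⟩
  have a2 := win_upper (B.win_W j) le_rfl hz
  rw [show E j + l j + (E (j + 1) - (E j + l j)) = E (j + 1) by omega] at a2
  rw [cnt_eq, cntI_split _ 0 (E j + l j) _ (by omega) a1.le]
  have a4 := cntI_le (Occ y r x) 0 (E j + l j)
  have a5 : N' * ((E j : ℝ) + l j) ≤ E (j + 1) := by
    have := B.hE j
    have h2 : N' ≤ j := by omega
    exact_mod_cast (by nlinarith : N' * (E j + l j) ≤ E (j + 1))
  have a6 : (N : ℝ) ≤ E (j + 1) := by exact_mod_cast (by omega : N ≤ E (j + 1))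
  rw [div_le_iff₀ hε] at hN hN'
  rw [Nat.sub_zero] at a4
  push_cast at a4
  have a7 : (0 : ℝ) ≤ (E j : ℝ) + l j := by positivity
  nlinarith

theorem L4 (B : Blk x V W E l) {y : ℕ → Fin k} (r : ℕ)
    (h : ∀ j, Abs y r (W j)) :
    y ∉ statOmega upperDensity x := by
  refine not_mem_upper r fun ε hε => ?_
  obtain ⟨N, hN⟩ := exists_nat_ge (4 * r / ε)
  obtain ⟨N', hN'⟩ := exists_nat_ge (2 / ε)
  filter_upwards [eventually_ge_atTop (max N (E (N' + 1)))] with n hn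
  obtain ⟨j, hj, h1, h2⟩ := B.locate N' n (by omega)
  have a1 := B.lt_E j
  have a2 := win_upper (B.win_W j) le_rfl (h j)
  rw [show E j + l j + (E (j + 1) - (E j + l j)) = E (j + 1) by omega] at a2
  have a3 : cntI (Occ y r x) (E (j + 1)) n ≤ l (j + 1) + r := by
    by_cases hc : E (j + 1) + l (j + 1) ≤ n
    · have := win_upper (m := n - (E (j + 1) + l (j + 1))) (B.win_W (j + 1)) (by
        show n - _ ≤ E (j + 2) - _
        omega) (h (j + 1))
      rw [show E (j + 1) + l (j + 1) + (n - (E (j + 1) + l (j + 1))) = n by omega] at this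
      rw [cntI_split _ (E (j + 1)) (E (j + 1) + l (j + 1)) n (by omega) hc]
      have h5 := cntI_le (Occ y r x) (E (j + 1)) (E (j + 1) + l (j + 1))
      simp only [add_tsub_cancel_left] at h5
      linarith
    · have h5 := cntI_le (Occ y r x) (E (j + 1)) n
      have h6 : ((n - E (j + 1) : ℕ) : ℝ) ≤ l (j + 1) + r := by exact_mod_cast (by omega)
      linarith
  rw [cnt_eq, cntI_split _ 0 (E j + l j) n (by omega) (by omega),
    cntI_split _ (E j + l j) (E (j + 1)) n (by omega) (by omega)]
  have a4 := cntI_le (Occ y r x) 0 (E j + l j)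
  rw [Nat.sub_zero] at a4
  push_cast at a4
  have a5 : N' * ((E j : ℝ) + l j + l (j + 1)) ≤ n := by
    have := B.hE j
    exact_mod_cast (by nlinarith : N' * (E j + l j + l (j + 1)) ≤ n)
  have a6 : (N : ℝ) ≤ n := by exact_mod_cast (by omega : N ≤ n)
  rw [div_le_iff₀ hε] at hN hN'
  have a7 : (0 : ℝ) ≤ (E j : ℝ) + l j + l (j + 1) := by positivity
  nlinarith

theorem L5 (B : Blk x V W E l) {y u : ℕ → Fin k} (hu : ∀ r, LD (Occ y r u))
    (h : ∃ᶠ j in atTop, V j = u) :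
    y ∈ statOmega banachUpperDensity x := by
  refine mem_banUpper fun r => ?_
  obtain ⟨d, hd, K0, hz0⟩ := hu r
  obtain ⟨K, hK, hz⟩ : ∃ K, 0 ≤ K ∧ ∀ n : ℕ, d * n - K ≤ cnt (Occ y r u) n :=
    ⟨max K0 0, le_max_right _ _, fun n => by
      have := hz0 n; have := le_max_left K0 0; linarith⟩
  refine ⟨d / 2, by positivity, ?_⟩
  obtain ⟨M, hM⟩ := exists_nat_ge ((K + d * r) * 2 / d)
  filter_upwards [eventually_ge_atTop M] with N hN
  obtain ⟨j, hj, hv⟩ := frequently_atTop.1 h N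
  refine ⟨E j, ?_⟩
  have h1 := win_lower (x := x) (a := E j) (M := l j) (m := N) (z := u) (y := y) (r := r)
    (fun i hi => by rw [B.hV j i hi, hv]) (by have := B.hl j; omega) hd hK hz
  have h2 : (M : ℝ) ≤ N := by exact_mod_cast hN
  rw [div_le_iff₀ hd] at hM
  nlinarith

theorem L6 (B : Blk x V W E l) {y u : ℕ → Fin k} (r : ℕ) (hu : Abs y r u)
    (h : ∃ᶠ j in atTop, V j = u) :
    y ∉ statOmega banachLowerDensity x := by
  refine not_mem_banLower r fun N => ?_
  obtain ⟨j, hj, hv⟩ := frequently_atTop.1 h (N + r)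
  refine ⟨E j, cntI_empty _ _ _ ?_⟩
  rintro t h1 h2 ⟨_, h3⟩
  refine hu (t - E j) fun i hi => ?_
  have := B.hl j
  rw [← h3 i hi, ← hv, ← B.hV j _ (by omega)]
  congr 1; omega

theorem phi_nonneg (x y : ℕ → Fin k) (t : ℝ) (n : ℕ) : 0 ≤ PhiN x y n t := by
  unfold PhiN; positivity

theorem phi_eq (x y : ℕ → Fin k) (t : ℝ) (n : ℕ) :
    PhiN x y n t = cnt {i | shiftDist (shift^[i] x) (shift^[i] y) < t} n / n := by
  unfold PhiN cnt
  congr 3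
  ext i; simp [and_comm]

theorem phi_le (x y : ℕ → Fin k) (t : ℝ) (n : ℕ) : PhiN x y n t ≤ 1 := by
  rw [phi_eq]; exact ratio_le _ _

theorem dc1 {x' : ℕ → Fin k} {V' W' : ℕ → ℕ → Fin k}
    (B : Blk x V W E l) (B' : Blk x' V' W' E l)
    (h1 : ∃ᶠ j in atTop, ∀ i, W j i ≠ W' j i) (h2 : ∃ᶠ j in atTop, W j = W' j) :
    DC1Pair x x' := by
  refine ⟨⟨1 / 2, by norm_num, ?_⟩, ?_⟩
  · refine le_antisymm ?_ ?_
    · refine le_of_forall_pos_le_add fun ε hε => ?_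
      rw [zero_add]
      refine liminf_le' (phi_nonneg x x' _) ?_
      obtain ⟨N', hN'⟩ := exists_nat_ge (1 / ε)
      rw [frequently_atTop] at h1 ⊢
      intro M
      obtain ⟨j, hj, hz⟩ := h1 (max M N')
      have a1 := B.lt_E j
      have a0 := B.ge_E j
      refine ⟨E (j + 1), by omega, ?_⟩
      rw [phi_eq, div_le_iff₀ (by exact_mod_cast (by omega)), cnt_eq,
        cntI_split _ 0 (E j + l j) _ (by omega) a1.le, cntI_empty _ (E j + l j)]
      · have a4 := cntI_le {i | shiftDist (shift^[i] x) (shift^[i] x') < 1 / 2} 0 (E j + l j)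
        rw [Nat.sub_zero] at a4
        push_cast at a4
        have a5 : N' * ((E j : ℝ) + l j) ≤ E (j + 1) := by
          have := B.hE j
          have h2 : N' ≤ j := by omega
          exact_mod_cast (by nlinarith : N' * (E j + l j) ≤ E (j + 1))
        rw [div_le_iff₀ hε] at hN'
        have a7 : (0 : ℝ) ≤ (E j : ℝ) + l j := by positivity
        nlinarith
      · intro m b1 b2 b3
        have b4 := lt_dist _ _ 1 (by simpa using b3) 0 (by norm_num)
        rw [shift_iter, shift_iter] at b4
        obtain ⟨i, rfl⟩ := Nat.exists_eq_add_of_le b1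
        rw [add_zero, B.hW j i b2, B'.hW j i b2] at b4
        exact hz i b4.symm
    · exact liminf_ge (phi_le x x' _) (Eventually.of_forall (phi_nonneg x x' _))
  · intro t ht
    refine le_antisymm (limsup_le' (phi_nonneg x x' t) (Eventually.of_forall (phi_le x x' t))) ?_
    refine le_of_forall_pos_le_add fun ε hε => ?_
    rw [← sub_le_iff_le_add]
    refine limsup_ge (phi_le x x' t) ?_
    obtain ⟨r, hr⟩ := dist_lt (k := k) t ht
    obtain ⟨N, hN⟩ := exists_nat_ge (2 * r / ε)
    obtain ⟨N', hN'⟩ := exists_nat_ge (2 / ε)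
    rw [frequently_atTop] at h2 ⊢
    intro M
    obtain ⟨j, hj, hz⟩ := h2 (max M (max r (max N N')))
    have a1 := B.lt_E j
    have a0 := B.ge_E j
    refine ⟨E (j + 1), by omega, ?_⟩
    have b0 : E j + l j + r ≤ E (j + 1) := by
      have c1 := B.hE j
      have c2 := B.hl j
      have c3 : E j + l j + l (j + 1) ≤ (j + 2) * (E j + l j + l (j + 1)) :=
        Nat.le_mul_of_pos_left _ (by omega)
      omega
    rw [phi_eq, le_div_iff₀ (by exact_mod_cast (by omega)), cnt_eq,
      cntI_split _ 0 (E j + l j) _ (by omega) a1.le]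
    set S := {i | shiftDist (shift^[i] x) (shift^[i] x') < t} with hS
    have b1 := cntI_copy Set.univ S (E (j + 1) - (E j + l j) - r) (E j + l j) (by
      intro i hi _
      refine hr _ _ fun s hs => ?_
      rw [shift_iter, shift_iter, add_assoc (E j + l j), B.hW j _ (by omega),
        B'.hW j _ (by omega), hz])
    have b2 : cnt Set.univ (E (j + 1) - (E j + l j) - r) = (E (j + 1) : ℝ) - (E j + l j) - r := by
      unfold cnt
      rw [Set.univ_inter, ← Finset.coe_Iio, Set.ncard_coe_finset, Nat.card_Iio,
        Nat.cast_sub (by omega), Nat.cast_sub (by omega)]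
      push_cast; ring
    rw [b2] at b1
    rw [cntI_split S (E j + l j) (E j + l j + (E (j + 1) - (E j + l j) - r)) _ (by omega) (by omega)]
    have b3 := cntI_nonneg S 0 (E j + l j)
    have b4 := cntI_nonneg S (E j + l j + (E (j + 1) - (E j + l j) - r)) (E (j + 1))
    have a5 : N' * ((E j : ℝ) + l j) ≤ E (j + 1) := by
      have := B.hE j
      have h2 : N' ≤ j := by omega
      exact_mod_cast (by nlinarith : N' * (E j + l j) ≤ E (j + 1))
    have a6 : (N : ℝ) ≤ E (j + 1) := by exact_mod_cast (by omega : N ≤ E (j + 1))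
    rw [div_le_iff₀ hε] at hN hN'
    have a7 : (0 : ℝ) ≤ (E j : ℝ) + l j := by positivity
    nlinarith

end Blk

/-- The list `w` occurs in `z` at `m`. -/
def OccL {α : Type} (w : List α) (z : ℕ → α) (m : ℕ) : Prop :=
  ∀ i, i < w.length → w[i]? = some (z (m + i))

theorem occL_append {α : Type} {a b : List α} {z : ℕ → α} {m : ℕ} (h : OccL (a ++ b) z m) :
    OccL a z m ∧ OccL b z (m + a.length) := by
  constructor
  · intro i hi
    rw [← h i (by simp; omega), List.getElem?_append_left hi]
  · intro i hi
    rw [add_assoc, ← h (a.length + i) (by simp; omega), List.getElem?_append_right (by omega)]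
    congr 1; omega

theorem exists_limit {α : Type} (X : ℕ → List α) (hX : ∀ j, ∃ t, X (j + 1) = X j ++ t)
    (hlen : ∀ j, j ≤ (X j).length) : ∃ z : ℕ → α, ∀ j, OccL (X j) z 0 := by
  have key : ∀ i s n, n < (X i).length → (X (i + s))[n]? = (X i)[n]? ∧ n < (X (i + s)).length := by
    intro i s n hn
    induction s with
    | zero => exact ⟨rfl, hn⟩
    | succ s ih =>
      obtain ⟨t, ht⟩ := hX (i + s)
      rw [← add_assoc, ht, List.getElem?_append_left ih.2]
      exact ⟨ih.1, by have := ih.2; simp; omega⟩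
  refine ⟨fun n => (X (n + 1))[n]'(hlen (n + 1)), fun j n hn => ?_⟩
  rw [zero_add, ← List.getElem?_eq_getElem]
  rcases le_total j (n + 1) with h | h
  · obtain ⟨s, hs⟩ := Nat.exists_eq_add_of_le h
    rw [hs]; exact (key j s n hn).1.symm
  · obtain ⟨s, hs⟩ := Nat.exists_eq_add_of_le h
    rw [hs]; exact (key (n + 1) s n (hlen (n + 1))).1

/-- Words that can be freely concatenated inside `PiL`. -/
def Good {α : Type} (L : ℕ) (w : List α) : Prop :=
  (∀ i, i + L ≤ w.length → ∃ j₁ j₂ : ℕ, j₁ < L ∧ j₂ < L ∧ w[i + j₁]? ≠ w[i + j₂]?) ∧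
  2 ≤ w.length ∧ w[0]? ≠ w[1]? ∧ w[w.length - 2]? ≠ w[w.length - 1]?

theorem Good.append {α : Type} {L : ℕ} (hL : 3 ≤ L) {a b : List α} (ha : Good L a) (hb : Good L b) :
    Good L (a ++ b) := by
  obtain ⟨a1, a2, a3, a4⟩ := ha
  obtain ⟨b1, b2, b3, b4⟩ := hb
  have gl : ∀ i, i < a.length → (a ++ b)[i]? = a[i]? := fun i hi => List.getElem?_append_left hi
  have gr : ∀ i, (a ++ b)[a.length + i]? = b[i]? := fun i => by
    rw [List.getElem?_append_right (by omega)]; congr 1; omega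
  refine ⟨?_, by simp; omega, ?_, ?_⟩
  · intro i hi
    rw [List.length_append] at hi
    by_cases h1 : i + L ≤ a.length
    · obtain ⟨j1, j2, h2, h3, h4⟩ := a1 i h1
      refine ⟨j1, j2, h2, h3, ?_⟩
      rwa [gl _ (by omega), gl _ (by omega)]
    · by_cases h2 : a.length ≤ i
      · obtain ⟨t, rfl⟩ := Nat.exists_eq_add_of_le h2
        obtain ⟨j1, j2, h2, h3, h4⟩ := b1 t (by omega)
        refine ⟨j1, j2, h2, h3, ?_⟩
        rwa [add_assoc, gr, add_assoc, gr]
      · by_cases h3 : i + 2 ≤ a.length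
        · refine ⟨a.length - 2 - i, a.length - 1 - i, by omega, by omega, ?_⟩
          rw [gl _ (by omega), gl _ (by omega)]
          convert a4 using 3 <;> omega
        · refine ⟨1, 2, by omega, by omega, ?_⟩
          have e : i + 1 = a.length := by omega
          have e2 : i + 2 = a.length + 1 := by omega
          rw [e2, show i + 1 = a.length + 0 by omega, gr, gr]
          exact b3
  · rw [gl _ (by omega), gl _ (by omega)]; exact a3
  · rw [List.length_append, show a.length + b.length - 2 = a.length + (b.length - 2) by omega,
      show a.length + b.length - 1 = a.length + (b.length - 1) by omega, gr, gr]
    exact b4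

theorem PiL_of_good {k L : ℕ} {x : ℕ → Fin k}
    (h : ∀ n, ∃ w : List (Fin k), n ≤ w.length ∧ Good L w ∧ OccL w x 0) :
    x ∈ PiL k L ∧ x 0 ≠ x 1 := by
  constructor
  · intro i
    obtain ⟨w, h1, h2, h3⟩ := h (i + L)
    obtain ⟨j1, j2, h4, h5, h6⟩ := h2.1 i h1
    refine ⟨j1, j2, h4, h5, ?_⟩
    rw [h3 _ (by omega), h3 _ (by omega), zero_add, zero_add] at h6
    exact fun hc => h6 (by rw [hc])
  · obtain ⟨w, h1, h2, h3⟩ := h 2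
    have h6 := h2.2.2.1
    rw [h3 _ (by omega), h3 _ (by omega), zero_add, zero_add] at h6
    exact fun hc => h6 (by rw [hc])

/-- Prefix list. -/
def pre {α : Type} (z : ℕ → α) (n : ℕ) : List α := (List.range n).map z

theorem pre_len {α : Type} (z : ℕ → α) (n : ℕ) : (pre z n).length = n := by simp [pre]
theorem pre_get {α : Type} (z : ℕ → α) (n i : ℕ) (h : i < n) : (pre z n)[i]? = some (z i) := by
  simp [pre, h]

theorem occ_pre {α : Type} {z x : ℕ → α} {n m : ℕ} (h : OccL (pre z n) x m) :
    ∀ i < n, x (m + i) = z i := by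
  intro i hi
  have := h i (by rwa [pre_len])
  rw [pre_get _ _ _ hi] at this
  simpa using this.symm

/-- Points of `PiL` starting with two different symbols. -/
def Nice {k : ℕ} (L : ℕ) (z : ℕ → Fin k) : Prop := z ∈ PiL k L ∧ z 0 ≠ z 1

theorem Nice.good {k L : ℕ} {z : ℕ → Fin k} (h : Nice L z) {M : ℕ} (h1 : z M ≠ z (M + 1)) :
    Good L (pre z (M + 2)) := by
  refine ⟨?_, by rw [pre_len]; omega, ?_, ?_⟩
  · intro i hi
    rw [pre_len] at hi
    obtain ⟨j1, j2, h4, h5, h6⟩ := h.1 i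
    refine ⟨j1, j2, h4, h5, ?_⟩
    rw [pre_get _ _ _ (by omega), pre_get _ _ _ (by omega)]
    simpa using h6
  · rw [pre_get _ _ _ (by omega), pre_get _ _ _ (by omega)]
    simpa using h.2
  · rw [pre_len, pre_get _ _ _ (by omega), pre_get _ _ _ (by omega)]
    simpa using h1

theorem Nice.cut {k L : ℕ} {z : ℕ → Fin k} (h : Nice L z) (B : ℕ) :
    ∃ M ≥ B, z M ≠ z (M + 1) := by
  by_contra hc
  push Not at hc
  have h1 : ∀ i, z (B + i) = z B := by
    intro i
    induction i with
    | zero => rfl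
    | succ i ih => rw [← add_assoc, ← hc (B + i) (by omega), ih]
  obtain ⟨j1, j2, -, -, h6⟩ := h.1 B
  exact h6 (by rw [h1, h1])

theorem exists_x {k L : ℕ} (hL : 3 ≤ L) (V : ℕ → ℕ → Fin k) (F : ℕ → Bool → ℕ → Fin k) (e : ℕ → ℕ)
    (hV : ∀ j, Nice L (V j)) (hF : ∀ j b, Nice L (F j b))
    (hp : ∀ j n, F j false n = F j false (n + 1) ↔ F j true n = F j true (n + 1)) :
    ∃ E l : ℕ → ℕ, ∀ α : ℕ → Bool, ∃ x : ℕ → Fin k, x ∈ PiL k L ∧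
      Blk x V (fun j => F j (α (e j))) E l := by
  have h1 : ∀ j, ∃ n ≥ j, Good L (pre (V j) n) := fun j => by
    obtain ⟨M, hM, h⟩ := (hV j).cut j
    exact ⟨M + 2, by omega, (hV j).good h⟩
  choose l hl hlg using h1
  have h2 : ∀ j B, ∃ n ≥ B, ∀ b, Good L (pre (F j b) n) := fun j B => by
    obtain ⟨M, hM, h⟩ := (hF j false).cut B
    refine ⟨M + 2, by omega, fun b => ?_⟩
    cases b
    · exact (hF j false).good h
    · exact (hF j true).good (fun hc => h ((hp j M).2 hc))
  choose m hm hmg using h2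
  obtain ⟨E, hE0, hE⟩ : ∃ E : ℕ → ℕ, E 0 = 0 ∧
      ∀ j, E (j + 1) = E j + l j + m j ((j + 2) * (E j + l j + l (j + 1)) + 1) :=
    ⟨fun j => Nat.rec 0 (fun j E => E + l j + m j ((j + 2) * (E + l j + l (j + 1)) + 1)) j,
      rfl, fun j => rfl⟩
  refine ⟨E, l, fun α => ?_⟩
  obtain ⟨X, hX0, hX⟩ : ∃ X : ℕ → List (Fin k), X 0 = [] ∧
      ∀ j, X (j + 1) = X j ++ (pre (V j) (l j) ++ pre (F j (α (e j)))
        (m j ((j + 2) * (E j + l j + l (j + 1)) + 1))) :=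
    ⟨fun j => Nat.rec [] (fun j X => X ++ (pre (V j) (l j) ++ pre (F j (α (e j)))
      (m j ((j + 2) * (E j + l j + l (j + 1)) + 1)))) j, rfl, fun j => rfl⟩
  have hXl : ∀ j, (X j).length = E j := by
    intro j
    induction j with
    | zero => rw [hX0, hE0]; rfl
    | succ j ih => rw [hX, hE, List.length_append, List.length_append, pre_len, pre_len, ih]; omega
  have hEj : ∀ j, j ≤ E j := by
    intro j
    induction j with
    | zero => omega
    | succ j ih => have := hE j; have := hm j ((j + 2) * (E j + l j + l (j + 1)) + 1); omega
  obtain ⟨x, hx⟩ := exists_limit X (fun j => ⟨_, hX j⟩) (fun j => by rw [hXl]; exact hEj j)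
  have hg : ∀ j, Good L (X (j + 1)) := by
    intro j
    induction j with
    | zero =>
      rw [hX, hX0, List.nil_append]
      exact (hlg 0).append hL (hmg _ _ _)
    | succ j ih =>
      rw [hX]
      exact ih.append hL ((hlg _).append hL (hmg _ _ _))
  refine ⟨x, (PiL_of_good fun n => ⟨X (n + 1), by
    rw [hXl]; have := hEj (n + 1); omega, hg n, hx _⟩).1, ?_⟩
  have hocc : ∀ j, OccL (pre (V j) (l j)) x (E j) ∧ OccL (pre (F j (α (e j)))
      (m j ((j + 2) * (E j + l j + l (j + 1)) + 1))) x (E j + l j) := by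
    intro j
    have h3 := hx (j + 1)
    rw [hX] at h3
    have h4 := occL_append (occL_append h3).2
    rwa [hXl, pre_len, zero_add] at h4
  refine ⟨?_, ?_, hl, ?_⟩
  · intro j i hi
    exact occ_pre (hocc j).1 i hi
  · intro j i hi
    exact occ_pre (hocc j).2 i (by rw [hE] at hi; omega)
  · intro j
    have := hE j; have := hm j ((j + 2) * (E j + l j + l (j + 1)) + 1); omega

/-- Repetition of a word. -/
def rep {α : Type} : ℕ → List α → List α
  | 0, _ => []
  | n + 1, w => w ++ rep n w

theorem rep_len {α : Type} (n : ℕ) (w : List α) : (rep n w).length = n * w.length := by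
  induction n with
  | zero => simp [rep]
  | succ n ih => rw [rep, List.length_append, ih]; ring

theorem rep_G {α : Type} {G : List α → Prop} (hG : ∀ a b, G a → G b → G (a ++ b)) {w : List α}
    (hw : G w) (n : ℕ) : G (rep (n + 1) w) := by
  induction n with
  | zero => simpa [rep] using hw
  | succ n ih => rw [rep]; exact hG _ _ hw ih

theorem rep_occ {α : Type} {w : List α} {z : ℕ → α} {n m : ℕ} (h : OccL (rep n w) z m) :
    ∀ t < n, OccL w z (m + t * w.length) := by
  induction n generalizing m with
  | zero => intro t ht; omega
  | succ n ih =>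
    rw [rep] at h
    obtain ⟨h1, h2⟩ := occL_append h
    intro t ht
    cases t with
    | zero => simpa using h1
    | succ t =>
      have := ih h2 t (by omega)
      rwa [show m + (t + 1) * w.length = m + w.length + t * w.length by ring]

theorem cntI_rep (O : Set ℕ) (len : ℕ) (a : ℝ) (m N : ℕ)
    (h : ∀ t < N, a ≤ cntI O (m + t * len) (m + t * len + len)) :
    N * a ≤ cntI O m (m + N * len) := by
  induction N with
  | zero => simpa using cntI_nonneg _ _ _
  | succ N ih =>
    have h1 := ih fun t ht => h t (by omega)
    have h2 := h N (by omega)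
    rw [cntI_split O m (m + N * len) _ (by omega) (by nlinarith),
      show m + (N + 1) * len = m + N * len + len by ring]
    push_cast
    linarith

theorem univ_exists {α : Type} (G : List α → Prop) (hG : ∀ a b, G a → G b → G (a ++ b))
    (w : ℕ → List α) (hw : ∀ i, G (w i)) (hne : ∀ i, 1 ≤ (w i).length) :
    ∃ z : ℕ → α, (∀ n, ∃ l : List α, n ≤ l.length ∧ G l ∧ OccL l z 0) ∧
      ∀ i (O : Set ℕ), (∀ m, OccL (w i) z m → ∃ m' ∈ O, m ≤ m' ∧ m' < m + (w i).length) → LD O := by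
  let N : ℕ → ℕ := fun j => 2 ^ (j + 2) * (w (j + 1)).length
  have hN : ∀ j, 1 ≤ N j := fun j => Nat.mul_pos (by positivity) (hne _)
  obtain ⟨u, hu0, hu⟩ : ∃ u : ℕ → List α, u 0 = w 0 ∧
      ∀ j, u (j + 1) = rep (N j) (u j) ++ w (j + 1) :=
    ⟨fun j => Nat.rec (w 0) (fun j u => rep (N j) u ++ w (j + 1)) j, rfl, fun j => rfl⟩
  have hul : ∀ j, (u (j + 1)).length = N j * (u j).length + (w (j + 1)).length := fun j => by
    rw [hu, List.length_append, rep_len]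
  have hlen : ∀ j, j + 1 ≤ (u j).length := by
    intro j
    induction j with
    | zero => rw [hu0]; exact hne 0
    | succ j ih => rw [hul]; have := hne (j + 1); have := hN j; nlinarith
  have hpre : ∀ j, ∃ t, u (j + 1) = u j ++ t := by
    intro j
    obtain ⟨n, hn⟩ : ∃ n, N j = n + 1 := ⟨N j - 1, by have := hN j; omega⟩
    exact ⟨rep n (u j) ++ w (j + 1), by rw [hu, hn, rep, List.append_assoc]⟩
  have hGu : ∀ j, G (u j) := by
    intro j
    induction j with
    | zero => rw [hu0]; exact hw 0
    | succ j ih =>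
      obtain ⟨n, hn⟩ : ∃ n, N j = n + 1 := ⟨N j - 1, by have := hN j; omega⟩
      rw [hu, hn]; exact hG _ _ (rep_G hG ih n) (hw _)
  obtain ⟨z, hz⟩ := exists_limit u hpre (fun j => by have := hlen j; omega)
  refine ⟨z, fun n => ⟨u n, by have := hlen n; omega, hGu n, hz n⟩, ?_⟩
  intro i O hO
  set C : ℝ := ((u i).length : ℝ) with hC
  have hCpos : 0 < C := by
    have := hlen i
    rw [hC]; exact_mod_cast (by omega)
  -- base: every occurrence of `u i` contains a point of O
  have base : ∀ m, OccL (u i) z m → 1 ≤ cntI O m (m + (u i).length) := by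
    intro m hm
    have : ∃ m' ∈ O, m ≤ m' ∧ m' < m + (u i).length := by
      cases i with
      | zero => rw [hu0] at hm ⊢; exact hO m hm
      | succ i =>
        rw [hu] at hm
        obtain ⟨m', h1, h2, h3⟩ := hO _ (occL_append hm).2
        refine ⟨m', h1, by omega, ?_⟩
        rw [hul]; rw [rep_len] at h3; omega
    obtain ⟨m', h1, h2, h3⟩ := this
    unfold cntI
    have : 0 < (O ∩ Set.Ico m (m + (u i).length)).ncard :=
      (Set.ncard_pos (fin2 _ _ _)).2 ⟨m', h1, h2, h3⟩
    exact_mod_cast this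
  have main : ∀ s m, OccL (u (i + s)) z m →
      ((u (i + s)).length : ℝ) ≤ C * (2 - (1 / 2) ^ s) * cntI O m (m + (u (i + s)).length) := by
    intro s
    induction s with
    | zero =>
      intro m hm
      have := base m hm
      simp only [add_zero, pow_zero]
      nlinarith
    | succ s ih =>
      intro m hm
      rw [← add_assoc] at hm ⊢
      rw [hu] at hm
      obtain ⟨h1, -⟩ := occL_append hm
      have hs1 : (1 / 2 : ℝ) ^ s ≤ 1 := pow_le_one₀ (by norm_num) (by norm_num)
      have hs0 : (0 : ℝ) < (1 / 2) ^ s := by positivity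
      have hK : 0 < C * (2 - (1 / 2) ^ s) := mul_pos hCpos (by linarith)
      have h2 := cntI_rep O (u (i + s)).length ((u (i + s)).length / (C * (2 - (1 / 2) ^ s))) m (N (i + s))
        (fun t ht => by
          rw [div_le_iff₀ hK, mul_comm]
          exact ih _ (rep_occ h1 t ht))
      rw [mul_div_assoc', div_le_iff₀ hK] at h2
      have h3 : cntI O m (m + N (i + s) * (u (i + s)).length) ≤ cntI O m (m + (u (i + s + 1)).length) := by
        rw [hul, cntI_split O m (m + N (i + s) * (u (i + s)).length)
          (m + (N (i + s) * (u (i + s)).length + _)) (by omega) (by omega)]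
        linarith [cntI_nonneg O (m + N (i + s) * (u (i + s)).length)
          (m + (N (i + s) * (u (i + s)).length + (w (i + s + 1)).length))]
      set c := cntI O m (m + (u (i + s + 1)).length) with hc
      have h4 : ((w (i + s + 1)).length : ℝ) ≤
          (1 / 2) ^ (s + 2) * (N (i + s) * (u (i + s)).length) := by
        have h5 : (w (i + s + 1)).length * 2 ^ (s + 2) ≤ N (i + s) * (u (i + s)).length := by
          have h6 : 2 ^ (s + 2) ≤ 2 ^ (i + s + 2) := Nat.pow_le_pow_right (by norm_num) (by omega)
          have h7 := hlen (i + s)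
          calc (w (i + s + 1)).length * 2 ^ (s + 2)
              ≤ (w (i + s + 1)).length * 2 ^ (i + s + 2) := Nat.mul_le_mul_left _ h6
            _ = N (i + s) * 1 := by simp only [N]; ring
            _ ≤ _ := Nat.mul_le_mul_left _ (by omega)
        have h8 : ((w (i + s + 1)).length : ℝ) * 2 ^ (s + 2) ≤ N (i + s) * (u (i + s)).length := by
          exact_mod_cast h5
        rw [one_div, inv_pow, inv_mul_eq_div, le_div_iff₀ (by positivity)]
        exact h8
      rw [hul]
      push_cast
      set A : ℝ := (N (i + s) : ℝ) * (u (i + s)).length with hA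
      set q : ℝ := (1 / 2) ^ s with hq
      have e1 : (1 / 2 : ℝ) ^ (s + 2) = q / 4 := by rw [pow_add]; norm_num; ring
      have e2 : (1 / 2 : ℝ) ^ (s + 1) = q / 2 := by rw [pow_add]; norm_num; ring
      rw [e1] at h4
      rw [e2]
      have h9 : A ≤ c * (C * (2 - q)) := h2.trans (mul_le_mul_of_nonneg_right h3 hK.le)
      have hc0 : 0 ≤ c := cntI_nonneg _ _ _
      have hcC : 0 ≤ c * C := by positivity
      calc A + ((w (i + s + 1)).length : ℝ) ≤ A * (1 + q / 4) := by linarith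
        _ ≤ c * (C * (2 - q)) * (1 + q / 4) := mul_le_mul_of_nonneg_right h9 (by linarith)
        _ ≤ C * (2 - q / 2) * c := by nlinarith [mul_nonneg hcC (sq_nonneg q)]
  have main2 : ∀ J ≥ i, ∀ m, OccL (u J) z m →
      ((u J).length : ℝ) / (2 * C) ≤ cntI O m (m + (u J).length) := by
    intro J hJ m hm
    obtain ⟨s, rfl⟩ := Nat.exists_eq_add_of_le hJ
    have h1 := main s m hm
    have hs0 : (0 : ℝ) < (1 / 2) ^ s := by positivity
    rw [div_le_iff₀ (by positivity)]
    have := mul_nonneg hCpos.le (cntI_nonneg O m (m + (u (i + s)).length))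
    nlinarith
  refine ⟨1 / (4 * C), by positivity, 1, fun n => ?_⟩
  by_cases hn : n < (u i).length
  · have h1 := cnt_nonneg O n
    have h2 : (n : ℝ) ≤ C := by rw [hC]; exact_mod_cast hn.le
    have h3 : 1 / (4 * C) * n ≤ 1 := by
      rw [div_mul_eq_mul_div, div_le_one (by positivity)]; linarith
    linarith
  · have hex : ∃ J, n < (u J).length := ⟨n, by have := hlen n; omega⟩
    classical
    have hspec := Nat.find_spec hex
    have hmono : Monotone fun j => (u j).length := monotone_nat_of_le_succ (fun j => by
      have := hul j; have := hN j; nlinarith)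
    have hfi : i < Nat.find hex := by
      by_contra hc
      have := hmono (not_lt.1 hc)
      simp only at this
      omega
    obtain ⟨J, hJ⟩ : ∃ J, Nat.find hex = J + 1 := ⟨Nat.find hex - 1, by omega⟩
    have hmin := Nat.find_min hex (m := J) (by omega)
    rw [hJ, hul] at hspec
    have hocc := hz (J + 1)
    rw [hu] at hocc
    have hrep := rep_occ (occL_append hocc).1
    have hlJ := hlen J
    have hwN : (w (J + 1)).length ≤ N J * (u J).length := by
      have : (w (J + 1)).length * 1 ≤ (w (J + 1)).length * 2 ^ (J + 2) :=
        Nat.mul_le_mul_left _ Nat.one_le_two_pow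
      have h7 : (w (J + 1)).length * 2 ^ (J + 2) = N J := by simp only [N]; ring
      nlinarith
    obtain ⟨q, hq1, hq2, hq3⟩ : ∃ q, q ≤ N J ∧ q * (u J).length ≤ n ∧ n ≤ 2 * (q * (u J).length) := by
      by_cases hc : N J * (u J).length ≤ n
      · exact ⟨N J, le_rfl, hc, by omega⟩
      · refine ⟨n / (u J).length, ?_, Nat.div_mul_le_self _ _, ?_⟩
        · exact (Nat.div_lt_of_lt_mul (by rw [mul_comm]; omega)).le
        · have h1 := Nat.div_add_mod n (u J).length
          have h2 := Nat.mod_lt n (show 0 < (u J).length by omega)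
          have h3 : 1 ≤ n / (u J).length := (Nat.one_le_div_iff (by omega)).2 (by omega)
          nlinarith
    have h5 := cntI_rep O (u J).length _ 0 q (fun t ht => main2 J (by omega) _ (hrep t (by omega)))
    rw [cnt_eq, cntI_split O 0 (q * (u J).length) n (by omega) hq2]
    have h6 := cntI_nonneg O (q * (u J).length) n
    rw [zero_add] at h5
    have h7 : (n : ℝ) ≤ 2 * (q * (u J).length) := by exact_mod_cast hq3
    have h8 : 1 / (4 * C) * n ≤ q * ((u J).length / (2 * C)) := by
      rw [div_mul_eq_mul_div, mul_div_assoc', div_le_div_iff₀ (by positivity) (by positivity)]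
      nlinarith
    linarith

theorem exists_sched : ∃ g : ℕ → Fin 3 × ℕ × Fin 3, ∀ b, ∃ᶠ j in atTop, g j = b := by
  obtain ⟨h, hh⟩ := exists_surjective_nat (Fin 3 × ℕ × Fin 3)
  refine ⟨fun n => h (Nat.unpair n).1, fun b => ?_⟩
  obtain ⟨a, rfl⟩ := hh b
  rw [frequently_atTop]
  intro N
  exact ⟨Nat.pair a N, Nat.right_le_pair a N, by simp⟩

theorem LD_unif {ι : Type} [Finite ι] [Nonempty ι] (S : ι → Set ℕ) (h : ∀ t, LD (S t)) :
    ∃ d > (0 : ℝ), ∃ K : ℝ, ∀ t, ∀ n : ℕ, d * n - K ≤ cnt (S t) n := by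
  choose d hd K hK using h
  obtain ⟨t0, h0⟩ := Finite.exists_min d
  obtain ⟨t1, h1⟩ := Finite.exists_max K
  refine ⟨d t0, hd t0, K t1, fun t n => ?_⟩
  have e1 := hK t n
  have e2 := h0 t
  have e3 := h1 t
  have e4 : d t0 * n ≤ d t * n := mul_le_mul_of_nonneg_right e2 (by positivity)
  linarith

/-- The properties of the constructed points. -/
structure Props {k : ℕ} (F : Fin 3 → Bool → ℕ → Fin k) (x : ℕ → Fin k) : Prop where
  L1 : ∀ y, (∀ t b r, LD (Occ y r (F t b))) → y ∈ statOmega lowerDensity x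
  L2 : ∀ y t, (∀ b r, LD (Occ y r (F t b))) → y ∈ statOmega upperDensity x
  L3 : ∀ y t r, (∀ b, Abs y r (F t b)) → y ∉ statOmega lowerDensity x
  L4 : ∀ y r, (∀ t b, Abs y r (F t b)) → y ∉ statOmega upperDensity x

theorem core {k L : ℕ} (hL : 3 ≤ L) (F : Fin 3 → Bool → ℕ → Fin k) (u p q : ℕ → Fin k)
    (hF : ∀ t b, Nice L (F t b)) (nu : Nice L u) (np : Nice L p) (nq : Nice L q)
    (hp : ∀ t n, F t false n = F t false (n + 1) ↔ F t true n = F t true (n + 1))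
    (hab : ∀ n, F 0 false n ≠ F 0 true n) (hc : F 1 false = F 1 true)
    (hu : ∀ y ∈ PiL k L, ∀ r, LD (Occ y r u)) (hA : ∀ y, Abs y 4 p ∨ Abs y 4 q) :
    ∃ S : Set (ℕ → Fin k),
      S ⊆ {x | x ∈ PiL k L ∧ Recurrent x ∧ omegaLim x = PiL k L ∧
        statOmega banachUpperDensity x = PiL k L ∧ statOmega banachLowerDensity x = ∅ ∧ Props F x} ∧
      ¬ S.Countable ∧ DC1Scrambled S := by
  obtain ⟨g, hg⟩ := exists_sched
  let V : Fin 3 → ℕ → Fin k := ![u, p, q]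
  have hVn : ∀ s, Nice L (V s) := by
    intro s; fin_cases s
    · exact nu
    · exact np
    · exact nq
  obtain ⟨E, l, hx⟩ := exists_x hL (fun j => V (g j).2.2) (fun j => F (g j).1) (fun j => (g j).2.1)
    (fun j => hVn _) (fun j => hF _) (fun j => hp _)
  choose x hxP hB using hx
  have hdc : ∀ α β, α ≠ β → DC1Pair (x α) (x β) := by
    intro α β hne
    obtain ⟨i, hi⟩ := Function.ne_iff.1 hne
    refine Blk.dc1 (hB α) (hB β) ((hg (0, i, 0)).mono ?_) ((hg (1, 0, 0)).mono ?_)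
    · intro j hj n
      simp only [hj]
      cases h1 : α i <;> cases h2 : β i
      · exact absurd (h1.trans h2.symm) hi
      · exact hab n
      · exact (hab n).symm
      · exact absurd (h1.trans h2.symm) hi
    · intro j hj
      simp only [hj]
      cases h1 : α 0 <;> cases h2 : β 0 <;> simp_all
  have hnot : ∀ z : ℕ → Fin k, ¬ DC1Pair z z := by
    rintro z ⟨⟨s, hs, h⟩, -⟩
    have h1 : ∀ n, 1 ≤ n → PhiN z z n s = 1 := by
      intro n hn
      rw [Blk.phi_eq]
      have : {i | shiftDist (shift^[i] z) (shift^[i] z) < s} = Set.univ := by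
        ext i; simp [shiftDist, hs]
      rw [this]
      unfold cnt
      rw [Set.univ_inter, ← Finset.coe_Iio, Set.ncard_coe_finset, Nat.card_Iio, div_self]
      exact_mod_cast (by omega)
    have h2 : (1 : ℝ) ≤ liminf (fun n => PhiN z z n s) atTop :=
      liminf_ge (Blk.phi_le z z s) (by
        filter_upwards [eventually_ge_atTop 1] with n hn
        rw [h1 n hn])
    linarith
  have hinj : Function.Injective x := by
    intro α β h
    by_contra hne
    have := hdc α β hne
    rw [h] at this
    exact hnot _ this
  refine ⟨Set.range x, ?_, ?_, ?_, ?_⟩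
  · rintro _ ⟨α, rfl⟩
    have B := hB α
    have hban : PiL k L ⊆ statOmega banachUpperDensity (x α) := by
      intro y hy
      refine B.L5 (hu y hy) ((hg (0, 0, 0)).mono fun j hj => ?_)
      simp [hj, V]
    have hom : omegaLim (x α) = PiL k L :=
      Set.Subset.antisymm (omega_sub_PiL (hxP α)) (hban.trans (ban_sub_omega _))
    refine ⟨hxP α, ?_, hom, Set.Subset.antisymm (hom ▸ ban_sub_omega _) hban, ?_, ?_, ?_, ?_, ?_⟩
    · intro ε hε
      have : x α ∈ omegaLim (x α) := by rw [hom]; exact hxP α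
      obtain ⟨n, hn, h⟩ := this ε hε 1
      exact ⟨n, hn, h⟩
    · ext y
      simp only [Set.mem_empty_iff_false, iff_false]
      rcases hA y with h | h
      · refine B.L6 4 h ((hg (0, 0, 1)).mono fun j hj => ?_)
        simp [hj, V]
      · refine B.L6 4 h ((hg (0, 0, 2)).mono fun j hj => ?_)
        simp [hj, V]
    · intro y hy
      refine B.L1 fun r => ?_
      obtain ⟨d, hd, K, h⟩ := LD_unif (fun s : Fin 3 × Bool => Occ y r (F s.1 s.2))
        (fun s => hy s.1 s.2 r)
      exact ⟨d, hd, K, fun j => h ((g j).1, α (g j).2.1)⟩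
    · intro y t hy
      refine B.L2 fun r => ?_
      obtain ⟨d, hd, K, h⟩ := LD_unif (fun s : Bool => Occ y r (F t s)) (fun s => hy s r)
      refine ⟨d, hd, K, (hg (t, 0, 0)).mono fun j hj => ?_⟩
      simp only [hj]
      exact h _
    · intro y t r hy
      refine B.L3 r ((hg (t, 0, 0)).mono fun j hj => ?_)
      simp only [hj]
      exact hy _
    · intro y r hy
      exact B.L4 r fun j => hy _ _
  · intro hcount
    have h1 : (Set.univ : Set (ℕ → Bool)).Countable := by
      rw [← Set.image_univ] at hcount
      exact Set.countable_of_injective_of_countable_image hinj.injOn hcount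
    have h2 := Set.countable_univ_iff.1 h1
    have h3 : Uncountable (ℕ → Bool) := by
      rw [← Cardinal.aleph0_lt_mk_iff]
      have e : Cardinal.mk (ℕ → Bool) = 2 ^ Cardinal.aleph0 := by clear h1 h2; simp
      rw [e]; exact Cardinal.cantor _
    exact not_countable h2
  · refine ⟨x (fun _ => false), ⟨_, rfl⟩, x (fun _ => true), ⟨_, rfl⟩, fun h => ?_⟩
    have := congrFun (hinj h) 0
    simp at this
  · rintro _ ⟨α, rfl⟩ _ ⟨β, rfl⟩ hne
    exact hdc α β fun h => hne (by rw [h])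

/-- The universal point. -/
theorem exists_U {k L : ℕ} (hL : 3 ≤ L) (p : ℕ → Fin (k + 2)) (np : Nice L p) :
    ∃ u : ℕ → Fin (k + 2), Nice L u ∧ ∀ y ∈ PiL (k + 2) L, ∀ r, LD (Occ y r u) := by
  have : Nonempty {l : List (Fin (k + 2)) // Good L l} := ⟨⟨_, np.good (M := 0) np.2⟩⟩
  obtain ⟨w, hw⟩ := exists_surjective_nat {l : List (Fin (k + 2)) // Good L l}
  obtain ⟨u, h1, h2⟩ := univ_exists (Good L) (fun a b ha hb => ha.append hL hb)
    (fun i => (w i).1) (fun i => (w i).2) (fun i => by have := (w i).2.2.1; omega)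
  refine ⟨u, PiL_of_good h1, fun y hy r => ?_⟩
  let y' : ℕ → Fin (k + 2) := fun n => if n = 0 then y 0 + 1 else y (n - 1)
  have ny : Nice L y' := by
    have h0 : y' 0 ≠ y' 1 := by simp [y']
    refine ⟨fun i => ?_, h0⟩
    cases i with
    | zero => exact ⟨0, 1, by omega, by omega, h0⟩
    | succ i =>
      obtain ⟨j1, j2, a1, a2, a3⟩ := hy i
      refine ⟨j1, j2, a1, a2, ?_⟩
      simp only [y']
      rw [if_neg (by omega), if_neg (by omega), show i + 1 + j1 - 1 = i + j1 by omega,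
        show i + 1 + j2 - 1 = i + j2 by omega]
      exact a3
  obtain ⟨M, hM, hc⟩ := ny.cut r
  obtain ⟨i, hi⟩ := hw ⟨_, ny.good hc⟩
  refine h2 i _ fun m hm => ⟨m + 1, ⟨by omega, fun s hs => ?_⟩, by omega, ?_⟩
  · rw [hi] at hm
    have := occ_pre hm (s + 1) (by omega)
    rw [show m + 1 + s = m + (s + 1) by omega, this]
    simp [y']
  · rw [hi]; simp only [pre_len]; omega

theorem LD_periodic {k : ℕ} {y z : ℕ → Fin k} {r m0 T : ℕ} (hT : 1 ≤ T)
    (hz : ∀ n, z (n + T) = z n) (h : ∀ i < r, z (m0 + i) = y i) : LD (Occ y r z) := by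
  have hz' : ∀ t n, z (n + t * T) = z n := by
    intro t n
    induction t with
    | zero => simp
    | succ t ih => rw [← ih, ← hz (n + t * T)]; congr 1; ring
  have h1 : ∀ t, (1 : ℝ) ≤ cntI (Occ y r z) (m0 + 1 + t * T) (m0 + 1 + t * T + T) := by
    intro t
    have hm : m0 + (t + 1) * T ∈ Occ y r z := by
      refine ⟨by nlinarith, fun i hi => ?_⟩
      rw [← h i hi, ← hz' (t + 1) (m0 + i)]
      congr 1; ring
    unfold cntI
    have : 0 < (Occ y r z ∩ Set.Ico (m0 + 1 + t * T) (m0 + 1 + t * T + T)).ncard :=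
      (Set.ncard_pos (fin2 _ _ _)).2 ⟨_, hm, by
        have : (t + 1) * T = t * T + T := by ring
        simp only [Set.mem_Ico]; omega⟩
    exact_mod_cast this
  have hT0 : (0 : ℝ) < T := by exact_mod_cast hT
  refine ⟨1 / T, by positivity, (m0 + 1) / T + 1, fun n => ?_⟩
  by_cases hn : n < m0 + 1
  · have h2 : (n : ℝ) ≤ m0 + 1 := by exact_mod_cast hn.le
    have h3 : 1 / T * (n : ℝ) ≤ (m0 + 1) / T := by
      rw [div_mul_eq_mul_div, one_mul]; gcongr
    have := cnt_nonneg (Occ y r z) n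
    linarith
  · have h2 := cntI_rep (Occ y r z) T 1 (m0 + 1) ((n - (m0 + 1)) / T) (fun t _ => h1 t)
    have h3 := Nat.div_add_mod (n - (m0 + 1)) T
    have h4 := Nat.mod_lt (n - (m0 + 1)) (show 0 < T by omega)
    set N := (n - (m0 + 1)) / T with hN
    have h6 : N * T = T * N := mul_comm _ _
    rw [cnt_eq, cntI_split _ 0 (m0 + 1) n (by omega) (by omega),
      cntI_split _ (m0 + 1) (m0 + 1 + N * T) n (by omega) (by omega)]
    have h7 := cntI_nonneg (Occ y r z) 0 (m0 + 1)
    have h8 := cntI_nonneg (Occ y r z) (m0 + 1 + N * T) n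
    have h5 : (n : ℝ) ≤ m0 + 1 + (N + 1) * T := by
      have : n ≤ m0 + 1 + (N + 1) * T := by
        have : (N + 1) * T = T * N + T := by ring
        omega
      exact_mod_cast this
    have h9 : 1 / T * (n : ℝ) ≤ (m0 + 1) / T + (N + 1) := by
      rw [div_mul_eq_mul_div, one_mul, div_le_iff₀ hT0, add_mul, div_mul_cancel₀ _ hT0.ne']
      exact h5
    linarith

/-- 0101… -/
def seqP (k : ℕ) : ℕ → Fin (k + 2) := fun n => if n % 2 = 0 then 0 else 1
/-- 1010… -/
def seqP' (k : ℕ) : ℕ → Fin (k + 2) := fun n => if n % 2 = 0 then 1 else 0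
/-- 010010… -/
def seqQ (k : ℕ) : ℕ → Fin (k + 2) := fun n => if n % 3 = 1 then 1 else 0
/-- 110110… -/
def seqR (k : ℕ) : ℕ → Fin (k + 2) := fun n => if n % 3 = 2 then 0 else 1

theorem P_adj (k n : ℕ) : seqP k n ≠ seqP k (n + 1) := by
  unfold seqP
  rcases Nat.mod_two_eq_zero_or_one n with h | h
  · rw [if_pos h, if_neg (by omega)]; simp
  · rw [if_neg (by omega), if_pos (by omega)]; simp

theorem P'_eq (k n : ℕ) : seqP' k n = seqP k (n + 1) := by
  unfold seqP seqP'
  rcases Nat.mod_two_eq_zero_or_one n with h | h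
  · rw [if_pos h, if_neg (by omega)]
  · rw [if_neg (by omega), if_pos (by omega)]

theorem P_per (k n : ℕ) : seqP k (n + 2) = seqP k n := by
  unfold seqP; simp
theorem Q_per (k n : ℕ) : seqQ k (n + 3) = seqQ k n := by
  unfold seqQ; simp
theorem P'_adj (k n : ℕ) : seqP' k n ≠ seqP' k (n + 1) := by
  rw [P'_eq, P'_eq]; exact P_adj _ _
theorem P'_per (k n : ℕ) : seqP' k (n + 2) = seqP' k n := by
  rw [P'_eq, P'_eq, ← P_per k (n + 1)]

theorem nice_P {k L : ℕ} (hL : 3 ≤ L) : Nice L (seqP k) :=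
  ⟨fun i => ⟨0, 1, by omega, by omega, P_adj k i⟩, P_adj k 0⟩
theorem nice_P' {k L : ℕ} (hL : 3 ≤ L) : Nice L (seqP' k) :=
  ⟨fun i => ⟨0, 1, by omega, by omega, P'_adj k i⟩, P'_adj k 0⟩
theorem nice_Q {k L : ℕ} (hL : 3 ≤ L) : Nice L (seqQ k) := by
  refine ⟨fun i => ?_, by simp [seqQ]⟩
  have h : i % 3 = 0 ∨ i % 3 = 1 ∨ i % 3 = 2 := by omega
  rcases h with h | h | h
  · refine ⟨0, 1, by omega, by omega, ?_⟩
    unfold seqQ; rw [if_neg (by omega), if_pos (by omega)]; simp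
  · refine ⟨0, 1, by omega, by omega, ?_⟩
    unfold seqQ; rw [if_pos (by omega), if_neg (by omega)]; simp
  · refine ⟨0, 2, by omega, by omega, ?_⟩
    unfold seqQ; rw [if_neg (by omega), if_pos (by omega)]; simp
theorem R_mem {k L : ℕ} (hL : 3 ≤ L) : seqR k ∈ PiL (k + 2) L := by
  intro i
  have h : i % 3 = 0 ∨ i % 3 = 1 ∨ i % 3 = 2 := by omega
  rcases h with h | h | h
  · refine ⟨0, 2, by omega, by omega, ?_⟩
    unfold seqR; rw [if_neg (by omega), if_pos (by omega)]; simp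
  · refine ⟨0, 1, by omega, by omega, ?_⟩
    unfold seqR; rw [if_neg (by omega), if_pos (by omega)]; simp
  · refine ⟨0, 1, by omega, by omega, ?_⟩
    unfold seqR; rw [if_pos (by omega), if_neg (by omega)]; simp

/-- no 11 in z -/
def No11 {k : ℕ} (z : ℕ → Fin (k + 2)) : Prop := ∀ m, ¬ (z m = 1 ∧ z (m + 1) = 1)

theorem abs_R {k : ℕ} {z : ℕ → Fin (k + 2)} (h : No11 z) : Abs (seqR k) 2 z := by
  intro m hm
  exact h m ⟨by simpa [seqR] using hm 0 (by norm_num), by simpa [seqR] using hm 1 (by norm_num)⟩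

theorem no11_P (k : ℕ) : No11 (seqP k) := fun m h => P_adj k m (by rw [h.1, h.2])
theorem no11_P' (k : ℕ) : No11 (seqP' k) := fun m h => P'_adj k m (by rw [h.1, h.2])
theorem no11_Q (k : ℕ) : No11 (seqQ k) := by
  rintro m ⟨h1, h2⟩
  unfold seqQ at h1 h2
  split_ifs at h1 h2
  · omega
  all_goals simp at h1 h2

theorem P_03 (k m : ℕ) : seqP k (m + 3) ≠ seqP k m := by
  rw [show m + 3 = m + 1 + 2 by omega, P_per]; exact (P_adj k m).symm

theorem abs_P {k : ℕ} {y : ℕ → Fin (k + 2)} (h : y 0 = y 3) : Abs y 4 (seqP k) := fun m hm => by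
  apply P_03 k m
  have h1 := hm 0 (by norm_num)
  have h2 := hm 3 (by norm_num)
  rw [add_zero] at h1
  rw [h1, h2, h]

theorem abs_P' {k : ℕ} {y : ℕ → Fin (k + 2)} {r : ℕ} (h : Abs y r (seqP k)) :
    Abs y r (seqP' k) := fun m hm => h (m + 1) fun i hi => by
  rw [← hm i hi, P'_eq]; congr 1; omega

theorem abs_Q {k : ℕ} {y : ℕ → Fin (k + 2)} (h : y 0 ≠ y 3) : Abs y 4 (seqQ k) := fun m hm => by
  apply h
  rw [← hm 0 (by norm_num), ← hm 3 (by norm_num), Q_per, add_zero]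

theorem exists_Z (k : ℕ) {L : ℕ} (hL : 3 ≤ L) : ∃ z : ℕ → Fin (k + 2), Nice L z ∧ No11 z ∧
    (∀ r, LD (Occ (seqP k) r z)) ∧ (∀ r, LD (Occ (seqQ k) r z)) := by
  let G : List (Fin (k + 2)) → Prop := fun w => Good L w ∧ w[0]? = some 0 ∧
    ∀ i : ℕ, ¬ (w[i]? = some 1 ∧ w[i + 1]? = some 1)
  have hG : ∀ a b, G a → G b → G (a ++ b) := by
    rintro a b ⟨a1, a2, a3⟩ ⟨b1, b2, b3⟩
    have hl := a1.2.1
    refine ⟨a1.append hL b1, by rw [List.getElem?_append_left (by omega), a2], ?_⟩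
    rintro i ⟨h1, h2⟩
    rcases lt_trichotomy (i + 1) a.length with h | h | h
    · rw [List.getElem?_append_left (by omega)] at h1 h2
      exact a3 i ⟨h1, h2⟩
    · rw [List.getElem?_append_right (by omega), h, Nat.sub_self, b2] at h2
      simp at h2
    · rw [List.getElem?_append_right (by omega)] at h1 h2
      refine b3 (i - a.length) ⟨h1, ?_⟩
      rw [← h2]; congr 1; omega
  have hpre : ∀ (z : ℕ → Fin (k + 2)) (M : ℕ), Nice L z → No11 z → z 0 = 0 → z M ≠ z (M + 1) →
      G (pre z (M + 2)) := by
    intro z M h1 h2 h3 h4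
    refine ⟨h1.good h4, by rw [pre_get _ _ _ (by omega), h3], ?_⟩
    rintro i ⟨e1, e2⟩
    have hi : i + 1 < M + 2 := by
      by_contra hc
      rw [List.getElem?_eq_none (by rw [pre_len]; omega)] at e2
      simp at e2
    rw [pre_get _ _ _ (by omega)] at e1 e2
    exact h2 i ⟨by simpa using e1, by simpa using e2⟩
  obtain ⟨z, h1, h2⟩ := univ_exists G hG
    (fun i => pre (seqQ k) (3 * i + 4 + 2) ++ pre (seqP k) (i + 2))
    (fun i => hG _ _ (hpre _ _ (nice_Q hL) (no11_Q k) (by simp [seqQ]) (by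
        unfold seqQ; rw [if_pos (by omega), if_neg (by omega)]; simp))
      (hpre _ _ (nice_P hL) (no11_P k) (by simp [seqP]) (P_adj k i)))
    (fun i => by rw [List.length_append, pre_len]; omega)
  refine ⟨z, ?_, ?_, ?_, ?_⟩
  · exact PiL_of_good fun n => by
      obtain ⟨w, a1, a2, a3⟩ := h1 n
      exact ⟨w, a1, a2.1, a3⟩
  · rintro m ⟨e1, e2⟩
    obtain ⟨w, a1, a2, a3⟩ := h1 (m + 2)
    apply a2.2.2 m
    rw [a3 _ (by omega), a3 _ (by omega), zero_add, zero_add, e1, e2]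
    simp
  · intro r
    refine h2 r _ fun m hm => ?_
    have h3 := occ_pre (occL_append hm).2
    rw [pre_len] at h3
    refine ⟨m + (3 * r + 4 + 2), ⟨by omega, fun i hi => h3 i (by omega)⟩, by omega, ?_⟩
    rw [List.length_append, pre_len, pre_len]; omega
  · intro r
    refine h2 r _ fun m hm => ?_
    have h3 := occ_pre (occL_append hm).1
    refine ⟨m + 3, ⟨by omega, fun i hi => ?_⟩, by omega, ?_⟩
    · rw [add_assoc, h3 _ (by omega), add_comm 3 i, Q_per]
    · rw [List.length_append, pre_len, pre_len]; omega

/-- Four points arranged as a family. -/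
def mkF {α : Type} (a b c d : α) : Fin 3 → Bool → α
  | 0, false => a
  | 0, true => b
  | 1, _ => c
  | 2, _ => d

theorem mkF_all {α : Type} {P : α → Prop} {a b c d : α} (ha : P a) (hb : P b) (hc : P c) (hd : P d) :
    ∀ t s, P (mkF a b c d t s)
  | 0, false => ha
  | 0, true => hb
  | 1, _ => hc
  | 2, _ => hd

theorem mkF_0 {α : Type} {P : α → Prop} {a b c d : α} (ha : P a) (hb : P b) :
    ∀ s, P (mkF a b c d 0 s)
  | false => ha
  | true => hb

theorem main_core {k L : ℕ} (hL : 3 ≤ L) (i : Fin 6) (a b c d u : ℕ → Fin (k + 2))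
    (ha : Nice L a) (hb : Nice L b) (hc : Nice L c) (hd : Nice L d) (nu : Nice L u)
    (hu : ∀ y ∈ PiL (k + 2) L, ∀ r, LD (Occ y r u))
    (hab : ∀ n, a n ≠ b n) (hadj : ∀ n, a n = a (n + 1) ↔ b n = b (n + 1))
    (hcase : ∀ x : ℕ → Fin (k + 2), Props (mkF a b c d) x →
      statOmega upperDensity x ⊆ PiL (k + 2) L →
      strictOrEq (caseFlags i).1 ∅ (statOmega lowerDensity x) ∧
      strictOrEq (caseFlags i).2.1 (statOmega lowerDensity x) (statOmega upperDensity x) ∧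
      strictOrEq (caseFlags i).2.2 (statOmega upperDensity x) (PiL (k + 2) L)) :
    ∃ S : Set (ℕ → Fin (k + 2)),
      S ⊆ {x | x ∈ PiL (k + 2) L ∧ Recurrent x ∧ omegaLim x = PiL (k + 2) L ∧ SatCase i x} ∧
      ¬ S.Countable ∧ DC1Scrambled S := by
  obtain ⟨S, h1, h2, h3⟩ := core hL (mkF a b c d) u (seqP k) (seqQ k) (mkF_all ha hb hc hd) nu
    (nice_P hL) (nice_Q hL)
    (fun t => match t with
      | 0 => hadj
      | 1 => fun _ => Iff.rfl
      | 2 => fun _ => Iff.rfl) hab rfl hu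
    (fun y => by
      by_cases h : y 0 = y 3
      · exact Or.inl (abs_P h)
      · exact Or.inr (abs_Q h))
  refine ⟨S, fun x hx => ?_, h2, h3⟩
  obtain ⟨e1, e2, e3, e4, e5, e6⟩ := h1 hx
  refine ⟨e1, e2, e3, ?_⟩
  have h := hcase x e6 (e3 ▸ upper_sub_omega x)
  unfold SatCase
  rw [e4, e5, e3]
  exact ⟨h.1, h.2.1, h.2.2, rfl⟩

theorem ssub_of {α : Type} {A B : Set α} (h : A ⊆ B) (y : α) (h1 : y ∈ B) (h2 : y ∉ A) : A ⊂ B :=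
  ⟨h, fun hc => h2 (hc h1)⟩

theorem main_all (k L : ℕ) (hL : 3 ≤ L) (i : Fin 6) :
    ∃ S : Set (ℕ → Fin (k + 2)),
      S ⊆ {x | x ∈ PiL (k + 2) L ∧ Recurrent x ∧ omegaLim x = PiL (k + 2) L ∧ SatCase i x} ∧
      ¬ S.Countable ∧ DC1Scrambled S := by
  have nP : Nice L (seqP k) := nice_P hL
  have nP' : Nice L (seqP' k) := nice_P' hL
  have nQ : Nice L (seqQ k) := nice_Q hL
  have hR : seqR k ∈ PiL (k + 2) L := R_mem hL
  obtain ⟨u, nu, hu⟩ := exists_U hL (seqP k) nP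
  obtain ⟨z, nz, z11, hzP, hzQ⟩ := exists_Z k hL
  have hab : ∀ n, seqP k n ≠ seqP' k n := fun n => by rw [P'_eq]; exact P_adj k n
  have hadj : ∀ n, seqP k n = seqP k (n + 1) ↔ seqP' k n = seqP' k (n + 1) := fun n =>
    iff_of_false (P_adj k n) (P'_adj k n)
  have ldP : ∀ r, LD (Occ (seqP k) r (seqP k)) := fun r =>
    LD_periodic (m0 := 0) (T := 2) (by norm_num) (P_per k) (fun i _ => by rw [zero_add])
  have ldP' : ∀ r, LD (Occ (seqP k) r (seqP' k)) := fun r =>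
    LD_periodic (m0 := 1) (T := 2) (by norm_num) (P'_per k) (fun i _ => by
      rw [P'_eq, ← P_per k i]; congr 1; omega)
  have q03 : seqQ k 0 = seqQ k 3 := by simp [seqQ]
  have qP := abs_P q03
  have e1 : ∀ x : ℕ → Fin (k + 2), seqP k ∈ statOmega lowerDensity x →
      ∅ ⊂ statOmega lowerDensity x := fun x h => ssub_of (Set.empty_subset _) _ h (by simp)
  have bempty : ∀ (c d x : ℕ → Fin (k + 2)) (t : Fin 3),
      Props (mkF (seqP k) (seqP' k) c d) x → (∀ s, mkF (seqP k) (seqP' k) c d t s = seqQ k) →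
      ∅ = statOmega lowerDensity x := by
    intro c d x t X ht
    symm
    ext y
    simp only [Set.mem_empty_iff_false, iff_false]
    by_cases h : y 0 = y 3
    · exact X.L3 y 0 4 (mkF_0 (P := fun z => Abs y 4 z) (abs_P h) (abs_P' (abs_P h)))
    · exact X.L3 y t 4 fun s => by rw [ht s]; exact abs_Q h
  fin_cases i
  · -- case 1
    refine main_core hL _ u (fun n => u n + 1) u u u nu ⟨fun i => ?_, by simpa using nu.2⟩ nu nu nu hu
      (fun n => by simp) (fun n => by simp) fun x X hsub => ?_
    · obtain ⟨j1, j2, a1, a2, a3⟩ := nu.1 i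
      exact ⟨j1, j2, a1, a2, by simpa using a3⟩
    · have hsub2 : PiL (k + 2) L ⊆ statOmega lowerDensity x := fun y hy => X.L1 y fun t s r => by
        refine mkF_all (P := fun z => LD (Occ y r z)) (hu y hy r) ?_ (hu y hy r) (hu y hy r) t s
        have h3 : Occ y r (fun n => u n + 1) = Occ (fun n => y n - 1) r u := by
          ext m
          simp only [Occ, Set.mem_ofPred_eq, eq_sub_iff_add_eq]
        rw [h3]
        refine hu _ (fun i => ?_) r
        obtain ⟨j1, j2, a1, a2, a3⟩ := hy i
        exact ⟨j1, j2, a1, a2, by simpa using a3⟩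
      refine ⟨e1 x (hsub2 nP.1), ?_, ?_⟩
      · exact Set.Subset.antisymm (lower_sub_upper x) (hsub.trans hsub2)
      · exact Set.Subset.antisymm hsub (hsub2.trans (lower_sub_upper x))
  · -- case 2
    refine main_core hL _ (seqP k) (seqP' k) (seqP k) (seqP k) u nP nP' nP nP nu hu hab hadj
      fun x X hsub => ⟨e1 x ?_, ?_, ?_⟩
    · exact X.L1 _ fun t s r => mkF_all (P := fun z => LD (Occ _ r z)) (ldP r) (ldP' r) (ldP r) (ldP r) t s
    · refine Set.Subset.antisymm (lower_sub_upper x) fun y hy => X.L1 y fun t s r => ?_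
      have h1 : ¬ Abs y r (seqP k) := fun h =>
        X.L4 y r (mkF_all (P := fun z => Abs y r z) h (abs_P' h) h h) hy
      unfold Abs at h1
      push Not at h1
      obtain ⟨m, hm⟩ := h1
      have l1 : LD (Occ y r (seqP k)) := LD_periodic (T := 2) (by norm_num) (P_per k) hm
      have l2 : LD (Occ y r (seqP' k)) :=
        LD_periodic (m0 := m + 1) (T := 2) (by norm_num) (P'_per k) (fun i hi => by
          rw [P'_eq, ← hm i hi, ← P_per k (m + i)]; congr 1; omega)
      exact mkF_all (P := fun z => LD (Occ y r z)) l1 l2 l1 l1 t s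
    · exact ssub_of hsub _ nQ.1 (X.L4 _ 4 (mkF_all (P := fun z => Abs _ 4 z) qP (abs_P' qP) qP qP))
  · -- case 3
    refine main_core hL _ (seqP k) (seqP' k) (seqQ k) u u nP nP' nQ nu nu hu hab hadj
      fun x X hsub => ?_
    have hB := bempty _ _ x 1 X (fun s => rfl)
    have hC : PiL (k + 2) L ⊆ statOmega upperDensity x := fun y hy => X.L2 y 2 fun s r => hu y hy r
    refine ⟨hB, ?_, Set.Subset.antisymm hsub hC⟩
    rw [← hB]
    exact ssub_of (Set.empty_subset _) _ (hC nP.1) (by simp)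
  · -- case 4
    refine main_core hL _ (seqP k) (seqP' k) u u u nP nP' nu nu nu hu hab hadj
      fun x X hsub => ?_
    have hC : PiL (k + 2) L ⊆ statOmega upperDensity x := fun y hy => X.L2 y 2 fun s r => hu y hy r
    refine ⟨e1 x ?_, ?_, Set.Subset.antisymm hsub hC⟩
    · exact X.L1 _ fun t s r => mkF_all (P := fun z => LD (Occ _ r z)) (ldP r) (ldP' r)
        (hu _ nP.1 r) (hu _ nP.1 r) t s
    · exact ssub_of (lower_sub_upper x) _ (hC nQ.1)
        (X.L3 _ 0 4 (mkF_0 (P := fun z => Abs _ 4 z) qP (abs_P' qP)))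
  · -- case 5
    refine main_core hL _ (seqP k) (seqP' k) (seqQ k) (seqQ k) u nP nP' nQ nQ nu hu hab hadj
      fun x X hsub => ?_
    have hB := bempty _ _ x 1 X (fun s => rfl)
    refine ⟨hB, ?_, ?_⟩
    · rw [← hB]
      exact ssub_of (Set.empty_subset _) (seqP k) (X.L2 _ 0 fun s r =>
        mkF_0 (P := fun z => LD (Occ _ r z)) (ldP r) (ldP' r) s) (by simp)
    · exact ssub_of hsub _ hR (X.L4 _ 2 (mkF_all (P := fun z => Abs _ 2 z)
        (abs_R (no11_P k)) (abs_R (no11_P' k)) (abs_R (no11_Q k)) (abs_R (no11_Q k))))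
  · -- case 6
    refine main_core hL _ (seqP k) (seqP' k) z z u nP nP' nz nz nu hu hab hadj
      fun x X hsub => ⟨e1 x ?_, ?_, ?_⟩
    · exact X.L1 _ fun t s r => mkF_all (P := fun z => LD (Occ _ r z)) (ldP r) (ldP' r)
        (hzP r) (hzP r) t s
    · exact ssub_of (lower_sub_upper x) (seqQ k) (X.L2 _ 2 fun s r => hzQ r)
        (X.L3 _ 0 4 (mkF_0 (P := fun z => Abs _ 4 z) qP (abs_P' qP)))
    · exact ssub_of hsub _ hR (X.L4 _ 2 (mkF_all (P := fun z => Abs _ 2 z)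
        (abs_R (no11_P k)) (abs_R (no11_P' k)) (abs_R z11) (abs_R z11)))

end helpers

/-- **Lemma.** For `k ≥ 2`, `L ≥ 3` and each `i = 1,…,6`, the set of points of `Π_L` that
are recurrent, transitive in `Π_L` (i.e. with ω-limit set equal to `Π_L`), and satisfy
Case (i), contains an uncountable DC1-scrambled subset. -/
theorem PiL_case_DC1 (k L : ℕ) (hk : 2 ≤ k) (hL : 3 ≤ L) (i : Fin 6) :
    ∃ S : Set (ℕ → Fin k),
      S ⊆ {x | x ∈ PiL k L ∧ Recurrent x ∧ omegaLim x = PiL k L ∧ SatCase i x} ∧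
      ¬ S.Countable ∧ DC1Scrambled S := by
  obtain ⟨k', rfl⟩ : ∃ k', k = k' + 2 := ⟨k - 2, by omega⟩
  exact main_all k' L hL i
end
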